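/- arXiv:1207.0954 — 3 statements merged into one kernel-verified Lean document; each statement's English description precedes it below -/
import Mathlib

section
/- For any dimension n ≥ 1, the number of Farey points of level Q, i.e. |{p/q ∈ [0,1)^n : (p,q) ∈ Z^{n+1}, gcd(p,q)=1, 0 < q ≤ Q}|, is asymptotic to Q^{n+1}/((n+1)ζ(n+1)) as Q → ∞. -/
open Filter Topology

/-- Real zeta value: ζ(s) = ∑_{k≥1} 1/k^s. -/
noncomputable def zetaR (s : ℕ) : ℝ := ∑' k : ℕ, (1 : ℝ) / (k + 1) ^ s

/-- The Farey points of level Q in dimension n. -/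
def FareySet (n Q : ℕ) : Set (Fin n → ℝ) :=
  {x | ∃ (p : Fin n → ℤ) (q : ℤ), 0 < q ∧ q ≤ Q ∧
    Finset.univ.gcd (Fin.snoc p q : Fin (n + 1) → ℤ) = 1 ∧
    (∀ i, x i = p i / q) ∧ (∀ i, 0 ≤ x i ∧ x i < 1)}

theorem pow_add_mul_pow_mul_sub_le_pow {x y : ℝ} (hx : 0 ≤ x) (hy : 0 ≤ y) (k : ℕ) :
    x ^ (k + 1) + (k + 1) * x ^ k * (y - x) ≤ y ^ (k + 1) := by
  induction k with
  | zero => simp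
  | succ k ih =>
    have h1 := mul_le_mul_of_nonneg_left ih hy
    have h2 : 0 ≤ (k + 1) * x ^ k * (y - x) ^ 2 := by positivity
    push_cast
    ring_nf at h1 h2 ⊢
    linarith

/-- The power sum `1 ^ n + ⋯ + m ^ n`. -/
noncomputable def powerSum (n m : ℕ) : ℝ := ∑ i ∈ Finset.Ioc 0 m, (i : ℝ) ^ n

theorem powerSum_zero_right (n : ℕ) : powerSum n 0 = 0 := by simp [powerSum]

theorem powerSum_succ (n m : ℕ) :
    powerSum n (m + 1) = powerSum n m + ((m : ℝ) + 1) ^ n := by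
  simp [powerSum, Finset.sum_Ioc_succ_top]

theorem powerSum_nonneg (n m : ℕ) : 0 ≤ powerSum n m :=
  Finset.sum_nonneg fun _ _ => by positivity

theorem pow_succ_le_mul_powerSum (n m : ℕ) :
    (m : ℝ) ^ (n + 1) ≤ (n + 1) * powerSum n m := by
  induction m with
  | zero => simp [powerSum_zero_right]
  | succ m ih =>
    have h := pow_add_mul_pow_mul_sub_le_pow (x := (m : ℝ) + 1) (y := m)
      (by positivity) (by positivity) n
    rw [powerSum_succ]
    push_cast
    linarith

theorem mul_powerSum_le_succ_pow (n m : ℕ) :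
    (n + 1) * powerSum n m ≤ ((m : ℝ) + 1) ^ (n + 1) := by
  induction m with
  | zero => simp [powerSum_zero_right]
  | succ m ih =>
    have h := pow_add_mul_pow_mul_sub_le_pow (x := (m : ℝ) + 1) (y := (m : ℝ) + 1 + 1)
      (by positivity) (by positivity) n
    rw [powerSum_succ]
    push_cast
    linarith

theorem powerSum_le_pow_succ (n m : ℕ) : powerSum n m ≤ (m : ℝ) ^ (n + 1) := by
  calc powerSum n m ≤ ∑ i ∈ Finset.Ioc 0 m, (m : ℝ) ^ n := by
        refine Finset.sum_le_sum fun i hi => ?_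
        have : i ≤ m := (Finset.mem_Ioc.1 hi).2
        gcongr
    _ = (m : ℝ) ^ (n + 1) := by simp [pow_succ, mul_comm]

theorem tendsto_powerSum_div_pow (n : ℕ) :
    Tendsto (fun m : ℕ => powerSum n m / (m : ℝ) ^ (n + 1)) atTop (𝓝 (1 / (n + 1))) := by
  have hn : (0 : ℝ) < n + 1 := by positivity
  have hup : Tendsto (fun m : ℕ => (1 + 1 / (m : ℝ)) ^ (n + 1) / (n + 1)) atTop
      (𝓝 (1 / (n + 1))) := by
    have h := ((tendsto_one_div_atTop_nhds_zero_nat (𝕜 := ℝ)).const_add 1).pow (n + 1)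
    simpa using h.div_const ((n : ℝ) + 1)
  refine tendsto_of_tendsto_of_tendsto_of_le_of_le' tendsto_const_nhds hup ?_ ?_
  · filter_upwards [eventually_gt_atTop 0] with m hm
    have hm' : (0 : ℝ) < m := by exact_mod_cast hm
    rw [div_le_div_iff₀ hn (by positivity)]
    linarith [pow_succ_le_mul_powerSum n m]
  · filter_upwards [eventually_gt_atTop 0] with m hm
    have hm' : (0 : ℝ) < m := by exact_mod_cast hm
    have h : (1 + 1 / (m : ℝ)) ^ (n + 1) = ((m : ℝ) + 1) ^ (n + 1) / (m : ℝ) ^ (n + 1) := by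
      rw [← div_pow]
      congr 1
      field_simp
    rw [h, div_div, div_le_div_iff₀ (by positivity) (by positivity)]
    have := mul_le_mul_of_nonneg_right (mul_powerSum_le_succ_pow n m)
      (by positivity : 0 ≤ (m : ℝ) ^ (n + 1))
    linarith

theorem tendsto_natDiv_div_self {d : ℕ} :
    Tendsto (fun Q : ℕ => ((Q / d : ℕ) : ℝ) / Q) atTop (𝓝 (1 / d)) := by
  have h := (tendsto_nat_floor_mul_div_atTop (R := ℝ) (a := 1 / d) (by positivity)).comp
    tendsto_natCast_atTop_atTop
  refine h.congr fun Q => ?_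
  simp only [Function.comp_apply]
  rw [one_div_mul_eq_div, Nat.floor_div_eq_div]

theorem tendsto_powerSum_natDiv_div_pow (n : ℕ) {d : ℕ} (hd : 0 < d) :
    Tendsto (fun Q : ℕ => powerSum n (Q / d) / (Q : ℝ) ^ (n + 1)) atTop
      (𝓝 (1 / (n + 1) * (1 / d) ^ (n + 1))) := by
  have hdiv : Tendsto (fun Q : ℕ => Q / d) atTop atTop := Nat.tendsto_div_const_atTop hd.ne'
  have h := ((tendsto_powerSum_div_pow n).comp hdiv).mul
    ((tendsto_natDiv_div_self (d := d)).pow (n + 1))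
  refine h.congr' ?_
  filter_upwards [eventually_ge_atTop d] with Q hQ
  have hk : (0 : ℝ) < ((Q / d : ℕ) : ℝ) := by exact_mod_cast Nat.div_pos hQ hd
  simp only [Function.comp_apply]
  rw [div_pow]
  field_simp

open ArithmeticFunction in
theorem tendsto_sum_moebius_mul_powerSum {n : ℕ} (hn : 1 ≤ n) :
    Tendsto (fun Q : ℕ => (∑ d ∈ Finset.Ioc 0 Q, (moebius d : ℝ) * powerSum n (Q / d)) /
      (Q : ℝ) ^ (n + 1)) atTop
      (𝓝 (∑' d : ℕ, (moebius d : ℝ) * (1 / (n + 1) * (1 / d) ^ (n + 1)))) := by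
  have hμ (d : ℕ) : |(moebius d : ℝ)| ≤ 1 := by exact_mod_cast abs_moebius_le_one
  have key : Tendsto (fun Q : ℕ => ∑' d : ℕ,
      (moebius d : ℝ) * (powerSum n (Q / d) / (Q : ℝ) ^ (n + 1))) atTop
      (𝓝 (∑' d : ℕ, (moebius d : ℝ) * (1 / (n + 1) * (1 / d) ^ (n + 1)))) := by
    refine tendsto_tsum_of_dominated_convergence (bound := fun d : ℕ => 1 / (d : ℝ) ^ (n + 1))
      (Real.summable_one_div_nat_pow.2 (by omega)) (fun d => ?_) ?_
    · rcases Nat.eq_zero_or_pos d with rfl | hd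
      · simp
      · exact (tendsto_powerSum_natDiv_div_pow n hd).const_mul _
    · filter_upwards [eventually_gt_atTop 0] with Q hQ d
      rcases Nat.eq_zero_or_pos d with rfl | hd
      · simp
      have hQ' : (0 : ℝ) < Q := by exact_mod_cast hQ
      have hd' : (0 : ℝ) < d := by exact_mod_cast hd
      rw [Real.norm_eq_abs, abs_mul,
        abs_of_nonneg (div_nonneg (powerSum_nonneg n (Q / d)) (by positivity))]
      calc |(moebius d : ℝ)| * (powerSum n (Q / d) / (Q : ℝ) ^ (n + 1))
          ≤ 1 * (((Q : ℝ) / d) ^ (n + 1) / (Q : ℝ) ^ (n + 1)) := by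
            gcongr
            · exact div_nonneg (powerSum_nonneg _ _) (by positivity)
            · exact hμ d
            · exact (powerSum_le_pow_succ n _).trans
                (pow_le_pow_left₀ (by positivity) Nat.cast_div_le _)
        _ = 1 / (d : ℝ) ^ (n + 1) := by
            rw [div_pow]
            field_simp
  refine key.congr fun Q => ?_
  rw [tsum_eq_sum (s := Finset.Ioc 0 Q), Finset.sum_div]
  · exact Finset.sum_congr rfl fun d _ => (mul_div_assoc _ _ _).symm
  · intro d hd
    rcases Nat.eq_zero_or_pos d with rfl | hd0
    · simp
    · have : Q < d := by simpa [hd0] using hd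
      simp [Nat.div_eq_of_lt this, powerSum_zero_right]

theorem ofReal_zetaR {s : ℕ} (hs : 1 < s) : (zetaR s : ℂ) = riemannZeta s := by
  rw [zeta_eq_tsum_one_div_nat_add_one_cpow (by simpa using hs), zetaR, Complex.ofReal_tsum]
  simp

theorem zetaR_pos {s : ℕ} (hs : 1 < s) : 0 < zetaR s := by
  have h : Summable fun k : ℕ => (1 : ℝ) / (k + 1) ^ s := by
    simpa using (summable_nat_add_iff 1).2 (Real.summable_one_div_nat_pow.2 hs)
  exact h.tsum_pos (fun k => by positivity) 0 (by positivity)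

open ArithmeticFunction in
theorem tsum_moebius_div_pow {s : ℕ} (hs : 1 < s) :
    ∑' d : ℕ, (moebius d : ℝ) * (1 / d) ^ s = 1 / zetaR s := by
  have hs' : 1 < (s : ℂ).re := by simpa using hs
  have h := LSeries_zeta_mul_Lseries_moebius hs'
  rw [LSeries_zeta_eq_riemannZeta hs', ← ofReal_zetaR hs] at h
  have h2 : LSeries (fun d => ((moebius d : ℤ) : ℂ)) s =
      ((∑' d : ℕ, (moebius d : ℝ) * (1 / d) ^ s : ℝ) : ℂ) := by
    rw [LSeries, Complex.ofReal_tsum]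
    refine tsum_congr fun d => ?_
    rcases Nat.eq_zero_or_pos d with rfl | hd
    · simp
    · rw [LSeries.term_of_ne_zero hd.ne', Complex.cpow_natCast]
      push_cast
      rw [one_div, inv_pow, div_eq_mul_inv]
  rw [h2] at h
  rw [eq_div_iff (zetaR_pos hs).ne', mul_comm]
  exact_mod_cast h

/-- The integer vectors in `[0, q) ^ n` whose coordinates have no common factor with `q`. -/
def coprimeNumerators (n q : ℕ) : Finset (Fin n → ℕ) :=
  {p ∈ Fintype.piFinset fun _ => Finset.range q | q.gcd (Finset.univ.gcd p) = 1}

theorem card_range_filter_dvd {q d : ℕ} (hd : d ∣ q) (hq : 0 < q) :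
    (Finset.card {x ∈ Finset.range q | d ∣ x}) = q / d := by
  obtain ⟨k, rfl⟩ := hd
  have hd : 0 < d := Nat.pos_of_mul_pos_right hq
  rw [Nat.mul_div_cancel_left _ hd]
  have : {x ∈ Finset.range (d * k) | d ∣ x} = (Finset.range k).image (d * ·) := by
    ext x
    simp only [Finset.mem_filter, Finset.mem_range, Finset.mem_image]
    constructor
    · rintro ⟨hx, y, rfl⟩
      exact ⟨y, Nat.lt_of_mul_lt_mul_left hx, rfl⟩
    · rintro ⟨y, hy, rfl⟩
      exact ⟨Nat.mul_lt_mul_of_pos_left hy hd, dvd_mul_right _ _⟩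
  rw [this, Finset.card_image_of_injective _ (mul_right_injective₀ hd.ne'), Finset.card_range]

open ArithmeticFunction in
theorem sum_divisors_moebius {m : ℕ} :
    ∑ d ∈ m.divisors, moebius d = if m = 1 then 1 else 0 := by
  rw [← coe_mul_zeta_apply, moebius_mul_coe_zeta, one_apply]

open ArithmeticFunction in
theorem card_coprimeNumerators (n : ℕ) {q : ℕ} (hq : 0 < q) :
    ((coprimeNumerators n q).card : ℤ) = ∑ d ∈ q.divisors, moebius d * ((q / d : ℕ) : ℤ) ^ n := by
  rw [coprimeNumerators, Finset.card_filter]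
  push_cast
  simp_rw [← sum_divisors_moebius]
  have h (p : Fin n → ℕ) : ∑ d ∈ (q.gcd (Finset.univ.gcd p)).divisors, moebius d =
      ∑ d ∈ q.divisors, if ∀ i, d ∣ p i then moebius d else 0 := by
    rw [← Finset.sum_filter]
    refine Finset.sum_congr ?_ fun _ _ => rfl
    ext d
    simp [Nat.dvd_gcd_iff, Finset.dvd_gcd_iff, hq.ne']
  simp_rw [h]
  rw [Finset.sum_comm]
  refine Finset.sum_congr rfl fun d hd => ?_
  rw [← Finset.sum_filter, Finset.sum_const, nsmul_eq_mul, mul_comm]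
  congr 1
  have h2 : {p ∈ Fintype.piFinset fun _ : Fin n => Finset.range q | ∀ i, d ∣ p i} =
      Fintype.piFinset fun _ : Fin n => {x ∈ Finset.range q | d ∣ x} := by
    ext p
    simp [forall_and]
  rw [h2, Fintype.card_piFinset_const, card_range_filter_dvd (Nat.dvd_of_mem_divisors hd) hq]
  push_cast
  rfl

open ArithmeticFunction in
theorem sum_card_coprimeNumerators (n Q : ℕ) :
    ((∑ q ∈ Finset.Ioc 0 Q, (coprimeNumerators n q).card : ℕ) : ℝ) =
      ∑ d ∈ Finset.Ioc 0 Q, (moebius d : ℝ) * powerSum n (Q / d) := by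
  let f : ArithmeticFunction ℝ := ⟨fun k => if k = 0 then 0 else (k : ℝ) ^ n, by simp⟩
  have hf {k : ℕ} (hk : 0 < k) : f k = (k : ℝ) ^ n := by simp [f, hk.ne']
  have h := sum_Ioc_mul_eq_sum_sum ((moebius : ArithmeticFunction ℤ) : ArithmeticFunction ℝ) f Q
  calc _ = ∑ q ∈ Finset.Ioc 0 Q,
        (((moebius : ArithmeticFunction ℤ) : ArithmeticFunction ℝ) * f) q := by
        rw [Nat.cast_sum]
        refine Finset.sum_congr rfl fun q hq => ?_
        have hq := (Finset.mem_Ioc.1 hq).1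
        have hc : ((coprimeNumerators n q).card : ℝ) =
            ∑ d ∈ q.divisors, (moebius d : ℝ) * ((q / d : ℕ) : ℝ) ^ n := by
          have := congrArg (Int.cast : ℤ → ℝ) (card_coprimeNumerators n hq)
          push_cast at this
          exact this
        rw [hc, mul_apply, Nat.sum_divisorsAntidiagonal
          (fun a b => ((moebius : ArithmeticFunction ℤ) : ArithmeticFunction ℝ) a * f b)]
        refine Finset.sum_congr rfl fun d hd => ?_
        rw [hf (Nat.div_pos (Nat.divisor_le hd) (Nat.pos_of_mem_divisors hd)), intCoe_apply]
    _ = _ := by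
        rw [h]
        refine Finset.sum_congr rfl fun d hd => ?_
        rw [intCoe_apply, powerSum]
        congr 1
        exact Finset.sum_congr rfl fun k hk => hf (Finset.mem_Ioc.1 hk).1

theorem dvd_of_coprime_of_cross_mul_eq {n q q' : ℕ} {p p' : Fin n → ℕ}
    (hp : q.gcd (Finset.univ.gcd p) = 1) (h : ∀ i, p i * q' = p' i * q) : q ∣ q' := by
  have h1 : q ∣ Finset.univ.gcd fun i => q' * p i :=
    Finset.dvd_gcd fun i _ => ⟨p' i, by rw [mul_comm, h, mul_comm]⟩
  rw [Finset.gcd_mul_left] at h1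
  exact Nat.Coprime.dvd_of_dvd_mul_right hp (by simpa using h1)

theorem gcd_snoc_natCast {n : ℕ} (p : Fin n → ℕ) (q : ℕ) :
    Finset.univ.gcd (Fin.snoc (fun i => (p i : ℤ)) (q : ℤ) : Fin (n + 1) → ℤ) =
      ((q.gcd (Finset.univ.gcd p) : ℕ) : ℤ) := by
  refine dvd_antisymm_of_normalize_eq Finset.normalize_gcd (Int.normalize_coe_nat _) ?_ ?_
  · have hall (i : Fin (n + 1)) := Finset.gcd_dvd
      (f := (Fin.snoc (fun i => (p i : ℤ)) (q : ℤ) : Fin (n + 1) → ℤ)) (Finset.mem_univ i)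
    rw [← Int.natAbs_dvd, Int.natCast_dvd_natCast]
    refine Nat.dvd_gcd ?_ (Finset.dvd_gcd fun i _ => ?_)
    · simpa [← Int.natCast_dvd_natCast] using hall (Fin.last n)
    · simpa [← Int.natCast_dvd_natCast] using hall i.castSucc
  · refine Finset.dvd_gcd fun i _ => ?_
    refine Fin.lastCases ?_ (fun i => ?_) i
    · simpa [Int.natCast_dvd_natCast] using Nat.gcd_dvd_left _ _
    · simpa [Int.natCast_dvd_natCast] using
        (Nat.gcd_dvd_right _ _).trans (Finset.gcd_dvd (f := p) (Finset.mem_univ i))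

/-- The rational point with numerators `a.2` and common denominator `a.1`. -/
noncomputable def ratPoint (n : ℕ) (a : (_ : ℕ) × (Fin n → ℕ)) : Fin n → ℝ :=
  fun i => (a.2 i : ℝ) / a.1

theorem fareySet_eq_image (n Q : ℕ) :
    FareySet n Q = ratPoint n '' ((Finset.Ioc 0 Q).sigma (coprimeNumerators n)) := by
  ext x
  simp only [FareySet, Set.mem_ofPred_eq, Set.mem_image, Finset.mem_coe, Finset.mem_sigma,
    Finset.mem_Ioc, coprimeNumerators, Finset.mem_filter, Fintype.mem_piFinset, Finset.mem_range]
  constructor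
  · rintro ⟨p, q, hq, hqQ, hg, hx, h01⟩
    have hq' : (0 : ℝ) < q := by exact_mod_cast hq
    have hp0 (i) : 0 ≤ p i := by
      have := (h01 i).1
      rw [hx, le_div_iff₀ hq', zero_mul] at this
      exact_mod_cast this
    have hpq (i) : p i < q := by
      have := (h01 i).2
      rw [hx, div_lt_one hq'] at this
      exact_mod_cast this
    lift q to ℕ using hq.le
    lift p to Fin n → ℕ using hp0
    rw [gcd_snoc_natCast] at hg
    refine ⟨⟨q, p⟩, ⟨⟨by exact_mod_cast hq, by exact_mod_cast hqQ⟩,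
      fun i => Int.ofNat_lt.1 (hpq i), by exact_mod_cast hg⟩, ?_⟩
    ext i
    simp [ratPoint, hx]
  · rintro ⟨⟨q, p⟩, ⟨⟨hq, hqQ⟩, hpq, hg⟩, rfl⟩
    have hq' : (0 : ℝ) < q := by exact_mod_cast hq
    refine ⟨fun i => p i, q, by exact_mod_cast hq, by exact_mod_cast hqQ, ?_, ?_, ?_⟩
    · rw [gcd_snoc_natCast]
      exact_mod_cast hg
    · simp [ratPoint]
    · intro i
      refine ⟨by simp only [ratPoint]; positivity, ?_⟩
      simp only [ratPoint]
      rw [div_lt_one hq']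
      exact_mod_cast hpq i

theorem injOn_ratPoint (n Q : ℕ) :
    Set.InjOn (ratPoint n) ((Finset.Ioc 0 Q).sigma (coprimeNumerators n)) := by
  rintro ⟨q, p⟩ h ⟨q', p'⟩ h' heq
  simp only [Finset.mem_coe, Finset.mem_sigma, Finset.mem_Ioc, coprimeNumerators,
    Finset.mem_filter] at h h'
  have hq : (0 : ℝ) < q := by exact_mod_cast h.1.1
  have hq' : (0 : ℝ) < q' := by exact_mod_cast h'.1.1
  have hmul (i : Fin n) : p i * q' = p' i * q := by
    have := congrFun heq i
    simp only [ratPoint] at this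
    rw [div_eq_div_iff hq.ne' hq'.ne'] at this
    exact_mod_cast this
  obtain rfl : q = q' := Nat.dvd_antisymm (dvd_of_coprime_of_cross_mul_eq h.2.2 hmul)
    (dvd_of_coprime_of_cross_mul_eq h'.2.2 fun i => (hmul i).symm)
  obtain rfl : p = p' := funext fun i => Nat.eq_of_mul_eq_mul_right h.1.1 (hmul i)
  rfl

theorem ncard_fareySet (n Q : ℕ) :
    (FareySet n Q).ncard = ∑ q ∈ Finset.Ioc 0 Q, (coprimeNumerators n q).card := by
  rw [fareySet_eq_image, (injOn_ratPoint n Q).ncard_image, Set.ncard_coe_finset,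
    Finset.card_sigma]

/-- |F_Q| ~ Q^{n+1}/((n+1)ζ(n+1)) as Q → ∞. -/
theorem farey_count_asymptotic (n : ℕ) (hn : 1 ≤ n) :
    Tendsto (fun Q : ℕ =>
        ((FareySet n Q).ncard : ℝ) / ((Q : ℝ) ^ (n + 1) / ((n + 1) * zetaR (n + 1))))
      atTop (𝓝 1) := by
  have hz : 0 < zetaR (n + 1) := zetaR_pos (by omega)
  have hsum : ∑' d : ℕ, (ArithmeticFunction.moebius d : ℝ) * (1 / (n + 1) * (1 / d) ^ (n + 1)) =
      1 / ((n + 1) * zetaR (n + 1)) := by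
    simp_rw [mul_left_comm _ (1 / ((n : ℝ) + 1))]
    rw [tsum_mul_left, tsum_moebius_div_pow (by omega), div_mul_div_comm, one_mul]
  have h := (tendsto_sum_moebius_mul_powerSum hn).mul_const (((n : ℝ) + 1) * zetaR (n + 1))
  rw [hsum, one_div_mul_cancel (by positivity)] at h
  refine h.congr fun Q => ?_
  rw [ncard_fareySet, sum_card_coprimeNumerators, div_div_eq_mul_div, div_mul_eq_mul_div]
end

section
/- For any bounded measurable set D ⊂ [0,1)^n with boundary of Lebesgue measure zero and non-empty interior, |F_Q ∩ D| ~ vol(D) · Q^{n+1}/((n+1)ζ(n+1)) as Q → ∞; in other words, the Farey points F_Q become uniformly distributed in [0,1)^n. -/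
open Filter Topology MeasureTheory

/-- The rational points of `ℝⁿ` with (not necessarily minimal) common denominator `q`. -/
def fractions (n q : ℕ) : Set (Fin n → ℝ) :=
  {x | ∃ p : Fin n → ℤ, ∀ i, x i = p i / q}

/-- The rational points of `ℝⁿ` with minimal common denominator `q`. -/
def primitiveFractions (n q : ℕ) : Set (Fin n → ℝ) :=
  {x | ∃ p : Fin n → ℤ,
    Finset.univ.gcd (Fin.snoc p (q : ℤ) : Fin (n + 1) → ℤ) = 1 ∧ ∀ i, x i = p i / q}

open scoped Pointwise in
theorem fractions_eq_smul_span (n : ℕ) {q : ℕ} (hq : q ≠ 0) :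
    fractions n q = ((q : ℝ)⁻¹ •
      (Submodule.span ℤ (Set.range (Pi.basisFun ℝ (Fin n)))) : Set (Fin n → ℝ)) := by
  ext x
  have : NeZero q := ⟨hq⟩
  have hq' : (q : ℝ) ≠ 0 := Nat.cast_ne_zero.2 hq
  have h := BoxIntegral.unitPartition.mem_smul_span_iff (n := q) (v := x)
  erw [h]
  simp only [fractions, Set.mem_ofPred_eq, Set.mem_range]
  rw [← Classical.skolem (p := fun i (p : ℤ) => x i = p / q)]
  refine forall_congr' fun i => exists_congr fun p => ?_
  simp only [algebraMap_int_eq, eq_intCast]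
  rw [eq_div_iff hq', mul_comm, eq_comm]

theorem dvd_of_mem_primitiveFractions {n d e : ℕ} (hd : d ≠ 0) {x : Fin n → ℝ}
    (hxd : x ∈ primitiveFractions n d) (hxe : x ∈ fractions n e) (he : e ≠ 0) : d ∣ e := by
  obtain ⟨p, hp, hpx⟩ := hxd
  obtain ⟨r, hr⟩ := hxe
  have h : (d : ℤ) ∣ Finset.univ.gcd
      (fun i => (e : ℤ) * (Fin.snoc p (d : ℤ) : Fin (n + 1) → ℤ) i) := by
    refine Finset.dvd_gcd fun i _ => ?_
    refine Fin.lastCases ?_ (fun j => ?_) i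
    · simp
    · refine ⟨r j, ?_⟩
      have := (hpx j).symm.trans (hr j)
      field_simp at this
      simp only [Fin.snoc_castSucc]
      exact_mod_cast (by linarith : (e : ℝ) * p j = d * r j)
  rw [Finset.gcd_mul_left, hp] at h
  simpa [Int.natCast_dvd_natCast] using h

theorem primitiveFractions_subset_fractions (n q : ℕ) :
    primitiveFractions n q ⊆ fractions n q :=
  fun _ ⟨p, _, hp⟩ => ⟨p, hp⟩

theorem fractions_subset_of_dvd {n d e : ℕ} (he : e ≠ 0) (hde : d ∣ e) :
    fractions n d ⊆ fractions n e := by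
  rintro x ⟨p, hp⟩
  obtain ⟨k, rfl⟩ := hde
  refine ⟨fun i => k * p i, fun i => ?_⟩
  rw [hp i]
  have : (d : ℝ) ≠ 0 := by rintro h; simp_all
  have : (k : ℝ) ≠ 0 := by rintro h; simp_all
  push_cast
  field_simp

theorem exists_mem_primitiveFractions {n q : ℕ} (hq : q ≠ 0) {x : Fin n → ℝ}
    (hx : x ∈ fractions n q) : ∃ d, d ≠ 0 ∧ x ∈ primitiveFractions n d := by
  obtain ⟨p, hp⟩ := hx
  set v : Fin (n + 1) → ℤ := Fin.snoc p (q : ℤ) with hv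
  obtain ⟨w, hw, hw1⟩ := Finset.extract_gcd (s := Finset.univ) v Finset.univ_nonempty
  set g := Finset.univ.gcd v
  have hlast : (q : ℤ) = g * w (Fin.last n) := by simpa [hv] using hw (Fin.last n) (by simp)
  have hq' : (0 : ℤ) < q := by positivity
  have hg0 : 0 ≤ g := by
    have : normalize g = g := Finset.normalize_gcd
    exact Int.nonneg_of_normalize_eq_self this
  have hg : 0 < g := lt_of_le_of_ne hg0 (by rintro h; rw [← h] at hlast; simp at hlast; omega)
  have hl : 0 < w (Fin.last n) := by
    rw [hlast] at hq'
    exact pos_of_mul_pos_right hq' hg0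
  lift w (Fin.last n) to ℕ using hl.le with d hd
  refine ⟨d, by omega, fun i => w i.castSucc, ?_, fun i => ?_⟩
  · rw [← hw1]
    congr 1
    ext i
    refine Fin.lastCases ?_ (fun j => ?_) i
    · simp [hd]
    · simp
  · have h := hw i.castSucc (by simp)
    simp only [hv, Fin.snoc_castSucc] at h
    have hgR : (g : ℝ) ≠ 0 := by exact_mod_cast hg.ne'
    have hqR : (q : ℝ) = g * d := by exact_mod_cast hlast
    rw [hp i, h, hqR]
    push_cast
    rw [mul_div_mul_left _ _ hgR]

theorem fractions_eq_biUnion (n : ℕ) {q : ℕ} (hq : q ≠ 0) :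
    fractions n q = ⋃ d ∈ q.divisors, primitiveFractions n d := by
  ext x
  simp only [Set.mem_iUnion, Nat.mem_divisors, exists_prop]
  constructor
  · intro hx
    obtain ⟨d, hd, hxd⟩ := exists_mem_primitiveFractions hq hx
    exact ⟨d, ⟨dvd_of_mem_primitiveFractions hd hxd hx hq, hq⟩, hxd⟩
  · rintro ⟨d, ⟨hd, -⟩, hxd⟩
    exact fractions_subset_of_dvd hq hd (primitiveFractions_subset_fractions n d hxd)

theorem disjoint_primitiveFractions {n d e : ℕ} (hd : d ≠ 0) (he : e ≠ 0) (hde : d ≠ e) :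
    Disjoint (primitiveFractions n d) (primitiveFractions n e) := by
  refine Set.disjoint_left.2 fun x hxd hxe => hde <| Nat.dvd_antisymm ?_ ?_
  · exact dvd_of_mem_primitiveFractions hd hxd (primitiveFractions_subset_fractions n e hxe) he
  · exact dvd_of_mem_primitiveFractions he hxe (primitiveFractions_subset_fractions n d hxd) hd

theorem fareySet_inter_eq_biUnion {n : ℕ} (Q : ℕ) {D : Set (Fin n → ℝ)}
    (hD : D ⊆ {x | ∀ i, 0 ≤ x i ∧ x i < 1}) :
    FareySet n Q ∩ D = ⋃ q ∈ Finset.Ioc 0 Q, (primitiveFractions n q ∩ D) := by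
  ext x
  simp only [FareySet, primitiveFractions, Set.mem_iUnion, Finset.mem_Ioc, exists_prop,
    Set.mem_inter_iff, Set.mem_ofPred_eq]
  constructor
  · rintro ⟨⟨p, q, hq, hqQ, hg, hx, -⟩, hxD⟩
    lift q to ℕ using hq.le
    exact ⟨q, ⟨by omega, by omega⟩, ⟨p, hg, by simpa using hx⟩, hxD⟩
  · rintro ⟨q, ⟨hq, hqQ⟩, ⟨p, hg, hx⟩, hxD⟩
    exact ⟨⟨p, q, by omega, by omega, hg, by simpa using hx, hD hxD⟩, hxD⟩

theorem finite_fractions_inter {n : ℕ} {q : ℕ} (hq : q ≠ 0) {D : Set (Fin n → ℝ)}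
    (hD : D ⊆ {x | ∀ i, 0 ≤ x i ∧ x i < 1}) : (fractions n q ∩ D).Finite := by
  have hq' : (0 : ℝ) < q := by positivity
  refine ((Set.finite_Icc (0 : Fin n → ℤ) (fun _ => (q : ℤ))).image
    (fun p i => (p i : ℝ) / q)).subset ?_
  rintro x ⟨⟨p, hp⟩, hxD⟩
  refine ⟨p, ⟨fun i => ?_, fun i => ?_⟩, funext fun i => (hp i).symm⟩
  · have h := (hD hxD i).1
    rw [hp i, le_div_iff₀ hq', zero_mul] at h
    exact_mod_cast h
  · have h := (hD hxD i).2
    rw [hp i, div_lt_one hq'] at h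
    exact_mod_cast h.le

theorem Set.ncard_biUnion_finset {ι α : Type*} (s : Finset ι) (f : ι → Set α)
    (hf : ∀ i ∈ s, (f i).Finite) (hs : (s : Set ι).PairwiseDisjoint f) :
    (⋃ i ∈ s, f i).ncard = ∑ i ∈ s, (f i).ncard := by
  classical
  induction s using Finset.induction_on with
  | empty => simp
  | insert a s ha ih =>
    have hs' : (⋃ i ∈ s, f i).Finite :=
      s.finite_toSet.biUnion fun i hi => hf i (Finset.mem_insert_of_mem hi)
    have hd : Disjoint (f a) (⋃ i ∈ s, f i) :=
      Set.disjoint_iUnion₂_right.2 fun i hi =>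
        hs (by simp) (by simp [hi]) (ne_of_mem_of_not_mem hi ha).symm
    rw [Finset.set_biUnion_insert, Finset.sum_insert ha,
      Set.ncard_union_eq hd (hf a (Finset.mem_insert_self a s)) hs',
      ih (fun i hi => hf i (Finset.mem_insert_of_mem hi)) (hs.subset (by simp))]

theorem tendsto_add_one_pow_sub_pow_div (n : ℕ) :
    Tendsto (fun q : ℕ => (((q : ℝ) + 1) ^ (n + 1) - (q : ℝ) ^ (n + 1)) / ((q : ℝ) + 1) ^ n)
      atTop (𝓝 (n + 1)) := by
  have ht : Tendsto (fun q : ℕ => (q : ℝ) / (q + 1)) atTop (𝓝 1) :=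
    tendsto_natCast_div_add_atTop 1
  have h : Tendsto (fun q : ℕ => ∑ i ∈ Finset.range (n + 1), ((q : ℝ) / (q + 1)) ^ i) atTop
      (𝓝 (∑ i ∈ Finset.range (n + 1), (1 : ℝ) ^ i)) :=
    tendsto_finsetSum _ fun i _ => ht.pow i
  simp only [one_pow, Finset.sum_const, Finset.card_range, nsmul_eq_mul, mul_one] at h
  push_cast at h
  refine h.congr fun q => ?_
  have hq : (q : ℝ) + 1 ≠ 0 := by positivity
  have hg := mul_neg_geom_sum ((q : ℝ) / (q + 1)) (n + 1)
  have h1 : 1 - (q : ℝ) / (q + 1) = 1 / (q + 1) := by field_simp; ring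
  rw [h1, one_div, inv_mul_eq_iff_eq_mul₀ hq] at hg
  rw [hg, div_pow]
  field_simp
  ring

/-- If `a q / q ^ n → V`, then the partial sums of `a` grow like `V / (n + 1) * Q ^ (n + 1)`. -/
theorem tendsto_sum_Ioc_div_pow {a : ℕ → ℝ} {n : ℕ} {V : ℝ}
    (ha : Tendsto (fun q : ℕ => a q / (q : ℝ) ^ n) atTop (𝓝 V)) :
    Tendsto (fun Q : ℕ => (∑ q ∈ Finset.Ioc 0 Q, a q) / (Q : ℝ) ^ (n + 1)) atTop
      (𝓝 (V / (n + 1))) := by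
  set g : ℕ → ℝ := fun q => ((q : ℝ) + 1) ^ (n + 1) - (q : ℝ) ^ (n + 1) with hg
  have hgpos (q : ℕ) : 0 < g q := sub_pos.2 (by gcongr; linarith)
  have hsum (Q : ℕ) : ∑ q ∈ Finset.range Q, g q = (Q : ℝ) ^ (n + 1) := by
    have := Finset.sum_range_sub (fun q : ℕ => (q : ℝ) ^ (n + 1)) Q
    simpa [hg] using this
  have hlim : Tendsto (fun q : ℕ => a (q + 1) / g q) atTop (𝓝 (V / (n + 1))) := by
    refine ((ha.comp (tendsto_add_atTop_nat 1)).div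
      (tendsto_add_one_pow_sub_pow_div n) (by positivity)).congr fun q => ?_
    have hq : (q : ℝ) + 1 ≠ 0 := by positivity
    have := (hgpos q).ne'
    simp only [hg, Pi.div_apply, Function.comp_apply, Nat.cast_add, Nat.cast_one] at this ⊢
    field_simp
  have hlittle : (fun q => a (q + 1) - V / (n + 1) * g q) =o[atTop] g := by
    refine (Asymptotics.isLittleO_iff_tendsto fun q hq => absurd hq (hgpos q).ne').2 ?_
    have := hlim.sub_const (V / (n + 1))
    rw [sub_self] at this
    refine this.congr fun q => ?_
    have := (hgpos q).ne'
    field_simp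
  have hpow : Tendsto (fun Q : ℕ => (Q : ℝ) ^ (n + 1)) atTop atTop :=
    (tendsto_pow_atTop n.succ_ne_zero).comp tendsto_natCast_atTop_atTop
  have hs := hlittle.sum_range (fun q => (hgpos q).le) (by simpa only [hsum] using hpow)
  simp only [hsum, Finset.sum_sub_distrib, ← Finset.mul_sum] at hs
  have := (hs.tendsto_div_nhds_zero).add_const (V / (n + 1))
  rw [zero_add] at this
  refine this.congr' ?_
  filter_upwards [eventually_gt_atTop 0] with Q hQ
  have hQ' : (Q : ℝ) ≠ 0 := by positivity
  have : ∑ q ∈ Finset.Ioc 0 Q, a q = ∑ q ∈ Finset.range Q, a (q + 1) := by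
    rw [Finset.range_eq_Ico, Finset.sum_Ico_add' a 0 Q 1]
    rfl
  rw [this]
  field_simp
  ring

/-- The average order of a Dirichlet convolution with the Möbius function. -/
theorem tendsto_sum_moebius_mul_div_pow {a : ArithmeticFunction ℝ} {n : ℕ} (hn : 1 ≤ n) {V : ℝ}
    (ha : Tendsto (fun q : ℕ => a q / (q : ℝ) ^ n) atTop (𝓝 V)) :
    Tendsto (fun Q : ℕ =>
        (∑ q ∈ Finset.Ioc 0 Q, ((ArithmeticFunction.moebius : ArithmeticFunction ℝ) * a) q) /
          (Q : ℝ) ^ (n + 1)) atTop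
      (𝓝 (∑' d : ℕ, (ArithmeticFunction.moebius d : ℝ) * (V / (n + 1) / (d : ℝ) ^ (n + 1)))) := by
  have hG := tendsto_sum_Ioc_div_pow ha
  set G : ℕ → ℝ := fun Q => ∑ q ∈ Finset.Ioc 0 Q, a q with hGdef
  obtain ⟨C, hC⟩ := hG.abs.bddAbove_range
  replace hC (m : ℕ) : |G m / (m : ℝ) ^ (n + 1)| ≤ C := hC ⟨m, rfl⟩
  have hC0 : 0 ≤ C := (abs_nonneg _).trans (hC 0)
  have hGbound (m : ℕ) : |G m| ≤ C * (m : ℝ) ^ (n + 1) := by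
    rcases Nat.eq_zero_or_pos m with rfl | hm
    · simp [hGdef]
    · have hm' : (0 : ℝ) < (m : ℝ) ^ (n + 1) := by positivity
      have := hC m
      rwa [abs_div, abs_of_pos hm', div_le_iff₀ hm'] at this
  have key : Tendsto (fun Q : ℕ => ∑' d : ℕ,
      (ArithmeticFunction.moebius d : ℝ) * (G (Q / d) / (Q : ℝ) ^ (n + 1))) atTop
      (𝓝 (∑' d : ℕ, (ArithmeticFunction.moebius d : ℝ) * (V / (n + 1) / (d : ℝ) ^ (n + 1)))) := by
    refine tendsto_tsum_of_dominated_convergence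
      (bound := fun d : ℕ => C * (1 / (d : ℝ) ^ (n + 1)))
      ((Real.summable_one_div_nat_pow.2 (by omega)).mul_left C) (fun d => ?_) ?_
    · rcases Nat.eq_zero_or_pos d with rfl | hd
      · simp
      refine Tendsto.const_mul _ ?_
      have hd' : (0 : ℝ) < d := by positivity
      have hdiv : Tendsto (fun Q : ℕ => Q / d) atTop atTop :=
        Nat.tendsto_div_const_atTop hd.ne'
      have hfloor : Tendsto (fun Q : ℕ => ((Q / d : ℕ) : ℝ) / Q) atTop (𝓝 (d : ℝ)⁻¹) := by
        refine ((tendsto_nat_floor_mul_div_atTop (inv_nonneg.2 hd'.le)).comp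
          tendsto_natCast_atTop_atTop).congr fun Q => ?_
        simp only [Function.comp_apply]
        rw [inv_mul_eq_div, Nat.floor_div_eq_div]
      have := (hG.comp hdiv).mul (hfloor.pow (n + 1))
      rw [inv_pow, ← div_eq_mul_inv] at this
      refine this.congr' ?_
      filter_upwards [eventually_ge_atTop d] with Q hQ
      have h1 : ((Q / d : ℕ) : ℝ) ≠ 0 := by
        have := Nat.div_pos hQ hd
        positivity
      simp only [Function.comp_apply]
      rw [div_pow, div_mul_div_cancel₀ (pow_ne_zero _ h1)]
    · filter_upwards [eventually_gt_atTop 0] with Q hQ d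
      have hQ' : (0 : ℝ) < Q := by positivity
      have hμ : |(ArithmeticFunction.moebius d : ℝ)| ≤ 1 := by
        exact_mod_cast ArithmeticFunction.abs_moebius_le_one
      rw [Real.norm_eq_abs, abs_mul, abs_div, abs_of_pos (pow_pos hQ' _)]
      calc _ ≤ 1 * (|G (Q / d)| / (Q : ℝ) ^ (n + 1)) := by gcongr
        _ ≤ 1 * (C * ((Q : ℝ) / d) ^ (n + 1) / (Q : ℝ) ^ (n + 1)) := by
          gcongr
          refine (hGbound _).trans ?_
          gcongr
          exact Nat.cast_div_le
        _ = C * (1 / (d : ℝ) ^ (n + 1)) := by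
          rw [div_pow]
          field_simp
  refine key.congr fun Q => ?_
  rw [ArithmeticFunction.sum_Ioc_mul_eq_sum_sum, Finset.sum_div,
    tsum_eq_sum (s := Finset.Ioc 0 Q)]
  · refine Finset.sum_congr rfl fun d _ => ?_
    rw [mul_div_assoc]
    simp [hGdef]
  · intro d hd
    rcases Nat.eq_zero_or_pos d with rfl | hd0
    · simp
    · have : Q / d = 0 := Nat.div_eq_of_lt (by simp at hd; omega)
      simp [this, hGdef]

theorem zetaR_mul_tsum_moebius {s : ℕ} (hs : 1 < s) :
    zetaR s * ∑' d : ℕ, (ArithmeticFunction.moebius d : ℝ) / (d : ℝ) ^ s = 1 := by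
  have hs' : 1 < (s : ℂ).re := by simpa using hs
  have h := ArithmeticFunction.LSeries_zeta_mul_Lseries_moebius hs'
  have hz : LSeries (fun n => (ArithmeticFunction.zeta n : ℂ)) s = (zetaR s : ℂ) := by
    rw [ArithmeticFunction.LSeries_zeta_eq_riemannZeta hs',
      zeta_eq_tsum_one_div_nat_add_one_cpow hs', zetaR]
    push_cast
    simp
  have hm : LSeries (fun n => (ArithmeticFunction.moebius n : ℂ)) s =
      ((∑' d : ℕ, (ArithmeticFunction.moebius d : ℝ) / (d : ℝ) ^ s : ℝ) : ℂ) := by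
    rw [LSeries]
    push_cast
    refine tsum_congr fun d => ?_
    rw [LSeries.term_def]
    split_ifs with hd
    · simp [hd]
    · simp
  rw [hz, hm] at h
  exact_mod_cast h

theorem sum_ncard_primitiveFractions_inter {n : ℕ} {D : Set (Fin n → ℝ)}
    (hD : D ⊆ {x | ∀ i, 0 ≤ x i ∧ x i < 1}) (q : ℕ) (hq : 0 < q) :
    ∑ d ∈ q.divisors, ((primitiveFractions n d ∩ D).ncard : ℝ) =
      ((fractions n q ∩ D).ncard : ℝ) := by
  rw [fractions_eq_biUnion n hq.ne', Set.iUnion₂_inter, Set.ncard_biUnion_finset, Nat.cast_sum]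
  · intro d hd
    exact (finite_fractions_inter (Nat.pos_of_mem_divisors hd).ne' hD).subset
      (Set.inter_subset_inter_left _ (primitiveFractions_subset_fractions n d))
  · intro d hd e he hde
    exact (disjoint_primitiveFractions (Nat.pos_of_mem_divisors hd).ne'
      (Nat.pos_of_mem_divisors he).ne' hde).mono Set.inter_subset_left Set.inter_subset_left

theorem ncard_fareySet_inter {n : ℕ} {D : Set (Fin n → ℝ)}
    (hD : D ⊆ {x | ∀ i, 0 ≤ x i ∧ x i < 1}) (Q : ℕ) :
    ((FareySet n Q ∩ D).ncard : ℝ) =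
      ∑ q ∈ Finset.Ioc 0 Q, ((primitiveFractions n q ∩ D).ncard : ℝ) := by
  have hpos {q : ℕ} (hq : q ∈ Finset.Ioc 0 Q) : q ≠ 0 := (Finset.mem_Ioc.1 hq).1.ne'
  rw [fareySet_inter_eq_biUnion Q hD, Set.ncard_biUnion_finset, Nat.cast_sum]
  · intro q hq
    exact (finite_fractions_inter (hpos hq) hD).subset
      (Set.inter_subset_inter_left _ (primitiveFractions_subset_fractions n q))
  · intro d hd e he hde
    exact (disjoint_primitiveFractions (hpos hd) (hpos he) hde).mono
      Set.inter_subset_left Set.inter_subset_left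

theorem tendsto_ncard_fractions_inter {n : ℕ} {D : Set (Fin n → ℝ)}
    (hD : Bornology.IsBounded D) (hmeas : MeasurableSet D) (hfront : volume (frontier D) = 0) :
    Tendsto (fun q : ℕ => ((fractions n q ∩ D).ncard : ℝ) / (q : ℝ) ^ n) atTop
      (𝓝 (volume D).toReal) := by
  have h := tendsto_card_div_pow_atTop_volume D hD hmeas hfront
  rw [Fintype.card_fin] at h
  refine h.congr' ?_
  filter_upwards [eventually_ne_atTop 0] with q hq
  rw [fractions_eq_smul_span n hq, Set.inter_comm, Set.ncard_def, Set.encard, Nat.card]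
  rfl

/-- uniform distribution of Farey points: for D ⊂ [0,1)^n with boundary
of Lebesgue measure zero and non-empty interior,
|F_Q ∩ D| ~ vol(D)·Q^{n+1}/((n+1)ζ(n+1)). -/
theorem farey_equidistribution (n : ℕ) (hn : 1 ≤ n) (D : Set (Fin n → ℝ))
    (hD : D ⊆ {x | ∀ i, 0 ≤ x i ∧ x i < 1}) (hmeas : MeasurableSet D)
    (hfront : volume (frontier D) = 0) (hint : (interior D).Nonempty) :
    Tendsto (fun Q : ℕ =>
        ((FareySet n Q ∩ D).ncard : ℝ) /
          ((volume D).toReal * ((Q : ℝ) ^ (n + 1) / ((n + 1) * zetaR (n + 1)))))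
      atTop (𝓝 1) := by
  have hDb : Bornology.IsBounded D :=
    (Metric.isBounded_Icc (0 : Fin n → ℝ) 1).subset fun x hx =>
      ⟨fun i => (hD hx i).1, fun i => (hD hx i).2.le⟩
  set V := (volume D).toReal with hV
  have hVpos : 0 < V := ENNReal.toReal_pos
    (Measure.measure_pos_of_nonempty_interior volume hint).ne' hDb.measure_lt_top.ne
  let a : ArithmeticFunction ℝ :=
    ⟨fun q => if q = 0 then 0 else ((fractions n q ∩ D).ncard : ℝ), by simp⟩
  have ha_apply {q : ℕ} (hq : q ≠ 0) : a q = ((fractions n q ∩ D).ncard : ℝ) := if_neg hq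
  have ha : Tendsto (fun q : ℕ => a q / (q : ℝ) ^ n) atTop (𝓝 V) := by
    refine (tendsto_ncard_fractions_inter hDb hmeas hfront).congr' ?_
    filter_upwards [eventually_ne_atTop 0] with q hq
    rw [ha_apply hq]
  have hlim := tendsto_sum_moebius_mul_div_pow hn ha
  have hcount (Q : ℕ) : ∑ q ∈ Finset.Ioc 0 Q,
      ((ArithmeticFunction.moebius : ArithmeticFunction ℝ) * a) q =
        ((FareySet n Q ∩ D).ncard : ℝ) := by
    rw [ncard_fareySet_inter hD]
    refine Finset.sum_congr rfl fun q hq => ?_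
    rw [ArithmeticFunction.mul_apply, ← ArithmeticFunction.sum_eq_iff_sum_mul_moebius_eq.1
      (sum_ncard_primitiveFractions_inter hD) q (Finset.mem_Ioc.1 hq).1]
    refine Finset.sum_congr rfl fun x hx => ?_
    rw [ha_apply (Nat.ne_zero_of_mem_divisorsAntidiagonal hx).2]
    rfl
  simp only [hcount] at hlim
  have hζ := zetaR_mul_tsum_moebius (s := n + 1) (by omega)
  have hζ0 : zetaR (n + 1) ≠ 0 := left_ne_zero_of_mul_eq_one hζ
  have hseries : ∑' d : ℕ, (ArithmeticFunction.moebius d : ℝ) *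
      (V / (n + 1) / (d : ℝ) ^ (n + 1)) = V / (n + 1) / zetaR (n + 1) := by
    rw [eq_div_iff hζ0, mul_comm]
    have : ∀ d : ℕ, (ArithmeticFunction.moebius d : ℝ) * (V / (n + 1) / (d : ℝ) ^ (n + 1)) =
        V / (n + 1) * ((ArithmeticFunction.moebius d : ℝ) / (d : ℝ) ^ (n + 1)) := fun d => by ring
    rw [tsum_congr this, tsum_mul_left, mul_left_comm, hζ, mul_one]
  rw [hseries] at hlim
  have hL : V / (n + 1) / zetaR (n + 1) ≠ 0 := by positivity
  have := hlim.div_const (V / (n + 1) / zetaR (n + 1))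
  rw [div_self hL] at this
  refine this.congr fun Q => ?_
  rw [div_div]
  congr 1
  field_simp
end

section
/- With σ_Q = Q^{n+1}/((n+1)ζ(n+1)) and C(A) = {(x,y) ∈ R^n × (0,1] : x ∈ σ_1^{-1/n} y A} for a bounded A ⊂ R^n, the expected number of primitive lattice points: ∑_{m ∈ Ẑ^{n+1}} 1_{C(A)}(m g) integrated over g ∈ SL(n+1,R)/SL(n+1,Z) with respect to Haar probability measure equals vol(C(A))/ζ(n+1) = vol(A). -/
open Matrix MeasureTheory Pointwise

noncomputable def sigma (n : ℕ) (Q : ℝ) : ℝ := Q ^ (n + 1) / ((n + 1) * zetaR (n + 1))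

/-- The cone C(A) = {(x,y) ∈ ℝ^n × (0,1] : x ∈ σ₁^{-1/n} y A} ⊂ ℝ^{n+1}. -/
noncomputable def Cone (n : ℕ) (A : Set (Fin n → ℝ)) : Set (Fin (n + 1) → ℝ) :=
  {v | 0 < v (Fin.last n) ∧ v (Fin.last n) ≤ 1 ∧
    (fun i : Fin n => v i.castSucc) ∈
      ((sigma n 1) ^ (-(1 : ℝ) / n) * v (Fin.last n)) • A}

/-- G = SL(n+1,ℝ). -/
abbrev G (n : ℕ) := Matrix.SpecialLinearGroup (Fin (n + 1)) ℝ

/-- Γ = SL(n+1,ℤ), viewed as a subgroup of SL(n+1,ℝ). -/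
noncomputable def GammaSub (n : ℕ) : Subgroup (G n) :=
  (Matrix.SpecialLinearGroup.map (n := Fin (n + 1)) (Int.castRingHom ℝ)).range

noncomputable instance (n : ℕ) : TopologicalSpace (G n) :=
  TopologicalSpace.induced (fun M => (M : Matrix (Fin (n + 1)) (Fin (n + 1)) ℝ)) inferInstance

noncomputable instance (n : ℕ) : MeasurableSpace (G n ⧸ GammaSub n) :=
  borel _

section InvariantMeasureUniqueness

open scoped ENNReal

variable {𝔾 : Type*} [Group 𝔾] {Γ : Subgroup 𝔾}

/-- The counting measure on the fibre of `𝔾 → 𝔾 ⧸ Γ` over `x`. -/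
noncomputable def fiberCount [MeasurableSpace 𝔾] (Γ : Subgroup 𝔾) (x : 𝔾 ⧸ Γ) : Measure 𝔾 :=
  Measure.sum fun γ : Γ => Measure.dirac (x.out * γ)

theorem lintegral_fiberCount_mk [MeasurableSpace 𝔾] (g : 𝔾) {f : 𝔾 → ℝ≥0∞} (hf : Measurable f) :
    ∫⁻ y, f y ∂(fiberCount Γ (g : 𝔾 ⧸ Γ)) = ∑' γ : Γ, f (g * γ) := by
  obtain ⟨δ, hδ⟩ := QuotientGroup.mk_out_eq_mul Γ g
  rw [fiberCount, lintegral_sum_measure]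
  simp_rw [lintegral_dirac' _ hf, hδ, mul_assoc]
  exact (Equiv.mulLeft δ).tsum_eq fun γ : Γ => f (g * γ)

theorem fiberCount_mk_apply [MeasurableSpace 𝔾] (g : 𝔾) {s : Set 𝔾} (hs : MeasurableSet s) :
    fiberCount Γ (g : 𝔾 ⧸ Γ) s = ∑' γ : Γ, s.indicator 1 (g * (γ : 𝔾)) := by
  rw [← lintegral_indicator_one hs, lintegral_fiberCount_mk g (measurable_one.indicator hs)]

theorem fiberCount_mk_apply_le [MeasurableSpace 𝔾] (g : 𝔾) {s : Set 𝔾} (hs : MeasurableSet s)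
    (hfin : {γ : Γ | (γ : 𝔾) ∈ s⁻¹ * s}.Finite) :
    fiberCount Γ (g : 𝔾 ⧸ Γ) s ≤ (hfin.toFinset.card : ℝ≥0∞) := by
  by_cases h : ∃ γ₀ : Γ, g * γ₀ ∈ s
  · obtain ⟨γ₀, h₀⟩ := h
    rw [fiberCount_mk_apply g hs, ← (Equiv.mulLeft γ₀).tsum_eq]
    rw [tsum_eq_sum (s := hfin.toFinset)]
    · refine (Finset.sum_le_card_nsmul _ _ 1 fun γ _ => ?_).trans (by simp)
      exact Set.indicator_le_self' (by simp) _
    · intro γ hγ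
      refine Set.indicator_of_notMem (fun h' => hγ ?_) _
      simp only [Set.Finite.mem_toFinset, Set.mem_ofPred_eq]
      refine ⟨(g * γ₀)⁻¹, by simpa using h₀, _, h', ?_⟩
      simp [mul_assoc]
  · push Not at h
    rw [fiberCount_mk_apply g hs]
    simp [Set.indicator_of_notMem (h _)]

/-- The uniform average of the Dirac masses at the points `g • s i`, for `x = gΓ`. -/
noncomputable def averageKernel [MeasurableSpace (𝔾 ⧸ Γ)] {ι : Type*} [Fintype ι] (s : ι → 𝔾 ⧸ Γ) (x : 𝔾 ⧸ Γ) :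
    Measure (𝔾 ⧸ Γ) :=
  (Fintype.card ι : ℝ≥0∞)⁻¹ • ∑ i, Measure.dirac (x.out • s i)

theorem lintegral_averageKernel_mk [MeasurableSpace (𝔾 ⧸ Γ)] {ι : Type*} [Fintype ι] {s : ι → 𝔾 ⧸ Γ}
    (hs : ∀ γ ∈ Γ, ∃ e : ι ≃ ι, ∀ i, γ • s i = s (e i)) (g : 𝔾)
    {f : 𝔾 ⧸ Γ → ℝ≥0∞} (hf : Measurable f) :
    ∫⁻ y, f y ∂(averageKernel s (g : 𝔾 ⧸ Γ)) =
      (Fintype.card ι : ℝ≥0∞)⁻¹ * ∑ i, f (g • s i) := by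
  obtain ⟨δ, hδ⟩ := QuotientGroup.mk_out_eq_mul Γ g
  obtain ⟨e, he⟩ := hs δ δ.2
  rw [averageKernel, lintegral_smul_measure, lintegral_finsetSum_measure, smul_eq_mul]
  simp_rw [lintegral_dirac' _ hf, hδ, mul_smul, he]
  rw [e.sum_comp fun i => f (g • s i)]

variable [TopologicalSpace 𝔾] [IsTopologicalGroup 𝔾] [PolishSpace 𝔾]
  [MeasurableSpace 𝔾] [BorelSpace 𝔾]

theorem exists_fiberCount_density [LocallyCompactSpace 𝔾] [Countable Γ]
    (hΓ : ∀ K : Set 𝔾, IsCompact K → {γ : Γ | (γ : 𝔾) ∈ K}.Finite) :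
    ∃ h : 𝔾 → ℝ≥0∞, Measurable h ∧
      ∀ x, ∫⁻ g, h g ∂(fiberCount Γ x) ≠ 0 ∧ ∫⁻ g, h g ∂(fiberCount Γ x) ≠ ∞ := by
  let K := compactCovering 𝔾
  have hK : ∀ n, IsCompact (K n) := isCompact_compactCovering 𝔾
  have hfin := fun n => hΓ _ ((hK n).inv.mul (hK n))
  let c : ℕ → ℝ≥0∞ := fun n => 2⁻¹ ^ n * ((hfin n).toFinset.card + 1 : ℝ≥0∞)⁻¹
  have hint : ∀ x, ∫⁻ g, ∑' n, c n * (K n).indicator 1 g ∂(fiberCount Γ x) =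
      ∑' n, c n * fiberCount Γ x (K n) := by
    intro x
    rw [lintegral_tsum fun n =>
      ((measurable_one.indicator (hK n).measurableSet).const_mul _).aemeasurable]
    congr with n
    rw [lintegral_const_mul _ (measurable_one.indicator (hK n).measurableSet),
      lintegral_indicator_one (hK n).measurableSet]
  refine ⟨fun g => ∑' n, c n * (K n).indicator 1 g, Measurable.tsum fun n =>
    (measurable_one.indicator (hK n).measurableSet).const_mul _, fun x => ?_⟩
  rw [hint]
  induction x using QuotientGroup.induction_on with
  | H g =>
    constructor
    · obtain ⟨n, hn⟩ : ∃ n, g ∈ K n := exists_mem_compactCovering g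
      rw [Ne, ENNReal.tsum_eq_zero, not_forall]
      refine ⟨n, mul_ne_zero (mul_ne_zero (by simp) (by simp [ENNReal.add_eq_top])) ?_⟩
      rw [fiberCount_mk_apply _ (hK n).measurableSet, Ne, ENNReal.tsum_eq_zero, not_forall]
      exact ⟨1, by simp [hn]⟩
    · refine ne_top_of_le_ne_top (b := ∑' n : ℕ, (2⁻¹ : ℝ≥0∞) ^ n) ?_
        (ENNReal.tsum_le_tsum fun n => ?_)
      · rw [ENNReal.tsum_geometric]; simp
      · rw [mul_assoc]
        refine mul_le_of_le_one_right' ?_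
        rw [mul_comm, ← div_eq_mul_inv]
        refine ENNReal.div_le_of_le_mul ?_
        rw [one_mul]
        exact (fiberCount_mk_apply_le g (hK n).measurableSet (hfin n)).trans le_self_add

variable [hcl : IsClosed (Γ : Set 𝔾)]
  [MeasurableSpace (𝔾 ⧸ Γ)] [BorelSpace (𝔾 ⧸ Γ)]

theorem measurable_of_comp_quotientMk {β : Type*} [MeasurableSpace β] {f : 𝔾 ⧸ Γ → β}
    (hf : Measurable fun g : 𝔾 => f g) : Measurable f :=
  ((QuotientGroup.continuous_mk (N := Γ)).measurable.measurable_comp_iff_of_surjective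
    QuotientGroup.mk_surjective).1 hf

theorem measurable_fiberCount [Countable Γ] : Measurable (fiberCount Γ) := by
  refine Measure.measurable_of_measurable_coe _ fun s hs => measurable_of_comp_quotientMk ?_
  simp_rw [fiberCount_mk_apply _ hs]
  refine Measurable.tsum fun γ => ?_
  exact (measurable_one.indicator hs).comp (measurable_mul_const _)

/-- The lift to `𝔾` of a measure on `𝔾 ⧸ Γ`. -/
noncomputable def liftMeasure (μ : Measure (𝔾 ⧸ Γ)) : Measure 𝔾 := μ.bind (fiberCount Γ)

theorem lintegral_liftMeasure [Countable Γ] (μ : Measure (𝔾 ⧸ Γ)) {f : 𝔾 → ℝ≥0∞}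
    (hf : Measurable f) :
    ∫⁻ g, f g ∂(liftMeasure μ) = ∫⁻ x, ∫⁻ g, f g ∂(fiberCount Γ x) ∂μ :=
  Measure.lintegral_bind measurable_fiberCount.aemeasurable hf.aemeasurable

theorem liftMeasure_isMulLeftInvariant [Countable Γ] {μ : Measure (𝔾 ⧸ Γ)}
    (hμ : ∀ g : 𝔾, MeasurePreserving (fun x : 𝔾 ⧸ Γ => g • x) μ μ) :
    (liftMeasure μ).IsMulLeftInvariant := by
  refine ⟨fun g => ?_⟩
  ext s hs
  have hs' : MeasurableSet ((fun h => g * h) ⁻¹' s) := measurable_const_mul g hs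
  rw [Measure.map_apply (measurable_const_mul g) hs, liftMeasure,
    Measure.bind_apply hs' measurable_fiberCount.aemeasurable,
    Measure.bind_apply hs measurable_fiberCount.aemeasurable,
    ← (hμ g).lintegral_comp (f := fun x => fiberCount Γ x s)
      ((Measure.measurable_coe hs).comp measurable_fiberCount)]
  congr 1
  ext x
  induction x using QuotientGroup.induction_on with
  | H h =>
    rw [MulAction.Quotient.smul_coe, smul_eq_mul]
    rw [fiberCount_mk_apply _ hs', fiberCount_mk_apply _ hs]
    exact tsum_congr fun γ => by rw [mul_assoc]; rfl

theorem liftMeasure_isFiniteMeasureOnCompacts [Countable Γ] (μ : Measure (𝔾 ⧸ Γ))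
    [IsFiniteMeasure μ] (hΓ : ∀ K : Set 𝔾, IsCompact K → {γ : Γ | (γ : 𝔾) ∈ K}.Finite) :
    IsFiniteMeasureOnCompacts (liftMeasure μ) := by
  refine ⟨fun K hK => ?_⟩
  have hfin := hΓ _ (hK.inv.mul hK)
  rw [liftMeasure, Measure.bind_apply hK.measurableSet measurable_fiberCount.aemeasurable]
  calc ∫⁻ x, fiberCount Γ x K ∂μ ≤ ∫⁻ _, (hfin.toFinset.card : ℝ≥0∞) ∂μ := by
        refine lintegral_mono fun x => ?_
        induction x using QuotientGroup.induction_on with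
        | H g => exact fiberCount_mk_apply_le g hK.measurableSet hfin
    _ < ∞ := by
        rw [lintegral_const]
        exact ENNReal.mul_lt_top (by simp) (measure_lt_top _ _)

/-- Uniqueness of the invariant probability measure on the quotient of a locally compact Polish
group by a countable closed subgroup meeting every compact set in a finite set. -/
theorem invariant_probabilityMeasure_unique [LocallyCompactSpace 𝔾] [Countable Γ]
    (hΓ : ∀ K : Set 𝔾, IsCompact K → {γ : Γ | (γ : 𝔾) ∈ K}.Finite)
    (μ ν : Measure (𝔾 ⧸ Γ)) [IsProbabilityMeasure μ] [IsProbabilityMeasure ν]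
    (hμ : ∀ g : 𝔾, MeasurePreserving (fun x : 𝔾 ⧸ Γ => g • x) μ μ)
    (hν : ∀ g : 𝔾, MeasurePreserving (fun x : 𝔾 ⧸ Γ => g • x) ν ν) : μ = ν := by
  obtain ⟨h, hm, hh⟩ := exists_fiberCount_density hΓ
  let H : 𝔾 ⧸ Γ → ℝ≥0∞ := fun x => ∫⁻ g, h g ∂(fiberCount Γ x)
  have hHm : Measurable H := (Measure.measurable_lintegral hm).comp measurable_fiberCount
  let I : (𝔾 ⧸ Γ → ℝ≥0∞) → ℝ≥0∞ := fun φ =>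
    ∫⁻ g, φ (g : 𝔾 ⧸ Γ) / H (g : 𝔾 ⧸ Γ) * h g ∂(Measure.haar : Measure 𝔾)
  have key : ∀ (ρ : Measure (𝔾 ⧸ Γ)) [IsProbabilityMeasure ρ],
      (∀ g : 𝔾, MeasurePreserving (fun x : 𝔾 ⧸ Γ => g • x) ρ ρ) →
      ∃ c : ℝ≥0∞, ∀ φ : 𝔾 ⧸ Γ → ℝ≥0∞, Measurable φ → ∫⁻ x, φ x ∂ρ = c * I φ := by
    intro ρ _ hρ
    have := liftMeasure_isMulLeftInvariant hρ
    have := liftMeasure_isFiniteMeasureOnCompacts ρ hΓ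
    have heq := Measure.isMulLeftInvariant_eq_smul (liftMeasure ρ) (Measure.haar : Measure 𝔾)
    refine ⟨(Measure.haarScalarFactor (liftMeasure ρ) Measure.haar : NNReal), fun φ hφ => ?_⟩
    have hfm : Measurable fun g : 𝔾 => φ (g : 𝔾 ⧸ Γ) / H (g : 𝔾 ⧸ Γ) * h g :=
      ((hφ.div hHm).comp QuotientGroup.continuous_mk.measurable).mul hm
    have h1 : ∫⁻ x, φ x ∂ρ =
        ∫⁻ g, φ (g : 𝔾 ⧸ Γ) / H (g : 𝔾 ⧸ Γ) * h g ∂(liftMeasure ρ) := by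
      rw [lintegral_liftMeasure _ hfm]
      congr with x
      induction x using QuotientGroup.induction_on with
      | H g =>
        rw [lintegral_fiberCount_mk _ hfm]
        have : ∀ γ : Γ, ((g * γ : 𝔾) : 𝔾 ⧸ Γ) = g := fun γ => by simp
        simp_rw [this, ENNReal.tsum_mul_left]
        rw [← lintegral_fiberCount_mk g hm]
        exact (ENNReal.div_mul_cancel (hh g).1 (hh g).2).symm
    rw [h1]
    conv_lhs => rw [heq]
    rw [lintegral_smul_measure]
    rfl
  obtain ⟨a, ha⟩ := key μ hμ
  obtain ⟨b, hb⟩ := key ν hν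
  have ha1 := ha 1 measurable_one
  have hb1 := hb 1 measurable_one
  simp only [Pi.one_apply, lintegral_const, measure_univ, mul_one] at ha1 hb1
  have hab : a = b := by
    rw [ENNReal.eq_inv_of_mul_eq_one_left ha1.symm, ENNReal.eq_inv_of_mul_eq_one_left hb1.symm]
  ext s hs
  rw [← lintegral_indicator_one hs, ← lintegral_indicator_one hs,
    ha _ (measurable_one.indicator hs), hb _ (measurable_one.indicator hs), hab]

theorem measurable_averageKernel {ι : Type*} [Fintype ι] {s : ι → 𝔾 ⧸ Γ}
    (hs : ∀ γ ∈ Γ, ∃ e : ι ≃ ι, ∀ i, γ • s i = s (e i)) : Measurable (averageKernel s) := by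
  refine Measure.measurable_of_measurable_coe _ fun t ht => measurable_of_comp_quotientMk ?_
  simp_rw [← lintegral_indicator_one ht,
    lintegral_averageKernel_mk hs _ (measurable_one.indicator ht)]
  refine (Finset.measurable_sum _ fun i _ => ?_).const_mul _
  exact (measurable_one.indicator ht).comp
    (continuous_id.smul continuous_const : Continuous fun g : 𝔾 => g • s i).measurable

/-- The invariant probability measure on `𝔾 ⧸ Γ` is stationary under averaging over a finite
`Γ`-invariant family of points. -/
theorem lintegral_lintegral_averageKernel [LocallyCompactSpace 𝔾] [Countable Γ]
    (hΓ : ∀ K : Set 𝔾, IsCompact K → {γ : Γ | (γ : 𝔾) ∈ K}.Finite)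
    (μ : Measure (𝔾 ⧸ Γ)) [IsProbabilityMeasure μ]
    (hμ : ∀ g : 𝔾, MeasurePreserving (fun x : 𝔾 ⧸ Γ => g • x) μ μ)
    {ι : Type*} [Fintype ι] [Nonempty ι] {s : ι → 𝔾 ⧸ Γ}
    (hs : ∀ γ ∈ Γ, ∃ e : ι ≃ ι, ∀ i, γ • s i = s (e i))
    {f : 𝔾 ⧸ Γ → ℝ≥0∞} (hf : Measurable f) :
    ∫⁻ x, ∫⁻ y, f y ∂(averageKernel s x) ∂μ = ∫⁻ x, f x ∂μ := by
  have hm := measurable_averageKernel hs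
  rw [← Measure.lintegral_bind hm.aemeasurable hf.aemeasurable]
  have hprob : IsProbabilityMeasure (μ.bind (averageKernel s)) := by
    refine ⟨?_⟩
    rw [Measure.bind_apply .univ hm.aemeasurable]
    have : ∀ x, averageKernel s x Set.univ = 1 := fun x => by
      simp only [averageKernel, Measure.smul_apply, Measure.finsetSum_apply, measure_univ,
        Finset.sum_const, Finset.card_univ, nsmul_eq_mul, mul_one, smul_eq_mul]
      exact ENNReal.inv_mul_cancel (by simp) (by simp)
    simp [this]
  congr 1
  refine invariant_probabilityMeasure_unique hΓ _ μ (fun g => ⟨measurable_const_smul g, ?_⟩) hμ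
  ext t ht
  have ht' : MeasurableSet ((fun x : 𝔾 ⧸ Γ => g • x) ⁻¹' t) := measurable_const_smul g ht
  rw [Measure.map_apply (measurable_const_smul g) ht, Measure.bind_apply ht' hm.aemeasurable,
    Measure.bind_apply ht hm.aemeasurable, ← (hμ g).lintegral_comp
      (f := fun x => averageKernel s x t) ((Measure.measurable_coe ht).comp hm)]
  congr 1
  ext x
  induction x using QuotientGroup.induction_on with
  | H h =>
    rw [MulAction.Quotient.smul_coe, smul_eq_mul, ← lintegral_indicator_one ht',
      ← lintegral_indicator_one ht,
      lintegral_averageKernel_mk hs _ (measurable_one.indicator ht'),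
      lintegral_averageKernel_mk hs _ (measurable_one.indicator ht)]
    congr 2
    ext i
    rw [mul_smul]
    rfl

end InvariantMeasureUniqueness

section SpecialLinearSetup

theorem isClosedEmbedding_coe_G (n : ℕ) :
    Topology.IsClosedEmbedding ((↑) : G n → Matrix (Fin (n + 1)) (Fin (n + 1)) ℝ) :=
  Matrix.SpecialLinearGroup.isClosedEmbedding_val

instance (n : ℕ) : IsTopologicalGroup (G n) :=
  Matrix.SpecialLinearGroup.topologicalGroup (n := Fin (n + 1)) (R := ℝ)

instance (n : ℕ) : PolishSpace (G n) :=
  have : PolishSpace (Matrix (Fin (n + 1)) (Fin (n + 1)) ℝ) :=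
    inferInstanceAs (PolishSpace (Fin (n + 1) → Fin (n + 1) → ℝ))
  (isClosedEmbedding_coe_G n).polishSpace

instance (n : ℕ) : LocallyCompactSpace (G n) :=
  have : LocallyCompactSpace (Matrix (Fin (n + 1)) (Fin (n + 1)) ℝ) :=
    inferInstanceAs (LocallyCompactSpace (Fin (n + 1) → Fin (n + 1) → ℝ))
  (isClosedEmbedding_coe_G n).locallyCompactSpace

noncomputable instance (n : ℕ) : MeasurableSpace (G n) := borel _

instance (n : ℕ) : BorelSpace (G n) := ⟨rfl⟩

instance (n : ℕ) : BorelSpace (G n ⧸ GammaSub n) := ⟨rfl⟩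

instance (n : ℕ) : Countable (GammaSub n) := by
  have : Countable (Matrix (Fin (n + 1)) (Fin (n + 1)) ℤ) :=
    inferInstanceAs (Countable (Fin (n + 1) → Fin (n + 1) → ℤ))
  have : Countable (SpecialLinearGroup (Fin (n + 1)) ℤ) := Subtype.countable
  exact (MonoidHom.rangeRestrict_surjective
    (SpecialLinearGroup.map (n := Fin (n + 1)) (Int.castRingHom ℝ))).countable

theorem isClosedEmbedding_map_intCast (n : ℕ) : Topology.IsClosedEmbedding
    (SpecialLinearGroup.map (n := Fin (n + 1)) (Int.castRingHom ℝ) :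
      SpecialLinearGroup (Fin (n + 1)) ℤ → G n) :=
  Topology.IsClosedEmbedding.specialLinearGroup_map (f := Int.castRingHom ℝ)
    Int.isClosedEmbedding_coe_real

instance (n : ℕ) : IsClosed (GammaSub n : Set (G n)) := by
  rw [GammaSub, MonoidHom.coe_range]
  exact (isClosedEmbedding_map_intCast n).isClosed_range

theorem finite_GammaSub_inter_isCompact (n : ℕ) (K : Set (G n)) (hK : IsCompact K) :
    {γ : GammaSub n | (γ : G n) ∈ K}.Finite := by
  have h1 := ((isClosedEmbedding_map_intCast n).isCompact_preimage hK).finite_of_discrete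
  refine Set.Finite.of_finite_image ((h1.image (SpecialLinearGroup.map
    (n := Fin (n + 1)) (Int.castRingHom ℝ))).subset ?_) Subtype.val_injective.injOn
  rintro _ ⟨⟨_, γ, rfl⟩, h, rfl⟩
  exact ⟨γ, h, rfl⟩

end SpecialLinearSetup

section LatticePoints

open scoped ENNReal

/-- The counting measure on the image of the set `P` of integer vectors under a representative
of `x`. -/
noncomputable def latticeMeasure {n : ℕ} (P : Set (Fin (n + 1) → ℤ)) (x : G n ⧸ GammaSub n) :
    Measure (Fin (n + 1) → ℝ) :=
  Measure.sum fun v : P => Measure.dirac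
    ((x.out : Matrix (Fin (n + 1)) (Fin (n + 1)) ℝ) *ᵥ fun i => ((v : Fin (n + 1) → ℤ) i : ℝ))

theorem mulVec_intCast {m : Type*} [Fintype m] (M : Matrix m m ℤ) (v : m → ℤ) :
    (M.map (Int.cast : ℤ → ℝ)) *ᵥ (fun i => (v i : ℝ)) = fun i => ((M *ᵥ v) i : ℝ) := by
  ext i
  simp [mulVec, dotProduct]

theorem mulVec_mulVec_of_mul_eq_one {m R : Type*} [Fintype m] [DecidableEq m] [CommRing R]
    {x y : SpecialLinearGroup m R} (h : x * y = 1) (v : m → R) :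
    (x : Matrix m m R) *ᵥ ((y : Matrix m m R) *ᵥ v) = v :=
  (mulVec_mulVec v _ _).trans
    ((congrArg (fun z => z.1 *ᵥ v) h).trans (one_mulVec v))

theorem latticeMeasure_mk_apply {n : ℕ} {P : Set (Fin (n + 1) → ℤ)}
    (hP : ∀ (γ : SpecialLinearGroup (Fin (n + 1)) ℤ) (v), v ∈ P →
      (γ : Matrix (Fin (n + 1)) (Fin (n + 1)) ℤ) *ᵥ v ∈ P)
    (g : G n) {C : Set (Fin (n + 1) → ℝ)} (hC : MeasurableSet C) :
    latticeMeasure P (g : G n ⧸ GammaSub n) C =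
      ∑' v : P, C.indicator 1 ((g : Matrix (Fin (n + 1)) (Fin (n + 1)) ℝ) *ᵥ
        fun i => ((v : Fin (n + 1) → ℤ) i : ℝ)) := by
  obtain ⟨⟨_, γ, rfl⟩, hδ⟩ := QuotientGroup.mk_out_eq_mul (GammaSub n) g
  let e : P ≃ P :=
    { toFun := fun v => ⟨_, hP γ v v.2⟩
      invFun := fun v => ⟨_, hP γ⁻¹ v v.2⟩
      left_inv := fun v => Subtype.ext (mulVec_mulVec_of_mul_eq_one (inv_mul_cancel γ) v)
      right_inv := fun v => Subtype.ext (mulVec_mulVec_of_mul_eq_one (mul_inv_cancel γ) v) }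
  rw [latticeMeasure, Measure.sum_apply _ hC]
  refine (tsum_congr fun v => ?_).trans (e.tsum_eq fun v : P => C.indicator 1
    ((g : Matrix (Fin (n + 1)) (Fin (n + 1)) ℝ) *ᵥ fun i => ((v : Fin (n + 1) → ℤ) i : ℝ)))
  rw [Measure.dirac_apply' _ hC, hδ]
  refine (congrArg (C.indicator 1) (mulVec_mulVec _ _ _).symm).trans ?_
  exact congrArg (fun w => C.indicator 1 ((g : Matrix (Fin (n + 1)) (Fin (n + 1)) ℝ) *ᵥ w))
    (mulVec_intCast _ _)

theorem measurable_latticeMeasure {n : ℕ} {P : Set (Fin (n + 1) → ℤ)}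
    (hP : ∀ (γ : SpecialLinearGroup (Fin (n + 1)) ℤ) (v), v ∈ P →
      (γ : Matrix (Fin (n + 1)) (Fin (n + 1)) ℤ) *ᵥ v ∈ P) :
    Measurable (latticeMeasure P) := by
  refine Measure.measurable_of_measurable_coe _ fun C hC => measurable_of_comp_quotientMk ?_
  simp_rw [latticeMeasure_mk_apply hP _ hC]
  refine Measurable.tsum fun v => (measurable_one.indicator hC).comp (Continuous.measurable ?_)
  exact (isClosedEmbedding_coe_G n).continuous.matrix_mulVec continuous_const

theorem mulVec_ne_zero_of_specialLinearGroup {m R : Type*} [Fintype m] [DecidableEq m] [CommRing R]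
    (γ : SpecialLinearGroup m R) (v : m → R) (hv : v ∈ ({0}ᶜ : Set (m → R))) :
    (γ : Matrix m m R) *ᵥ v ∈ ({0}ᶜ : Set (m → R)) := by
  intro h
  refine hv ?_
  have h' : (γ : Matrix m m R) *ᵥ v = 0 := h
  rw [← mulVec_mulVec_of_mul_eq_one (inv_mul_cancel γ) v, h', mulVec_zero]
  rfl

end LatticePoints

section HeckePoints

open scoped ENNReal

/-- `M` has determinant `p` and its columns generate the lattice of integer vectors orthogonal
to `a` modulo `p`. -/
def IsCongruenceBasis {n : ℕ} (p : ℕ) (a : Fin (n + 1) → ZMod p)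
    (M : Matrix (Fin (n + 1)) (Fin (n + 1)) ℤ) : Prop :=
  M.det = p ∧ ∀ v : Fin (n + 1) → ℤ, a ⬝ᵥ (fun i => (v i : ZMod p)) = 0 ↔ ∃ w, M *ᵥ w = v

theorem exists_isCongruenceBasis {n : ℕ} (p : ℕ) [Fact p.Prime] (a : Fin (n + 1) → ZMod p)
    (ha : a ≠ 0) : ∃ M, IsCongruenceBasis p a M := by
  obtain ⟨i, hi⟩ := Function.ne_iff.1 ha
  have hi' : a i ≠ 0 := hi
  let c : Fin (n + 1) → ℤ := fun j => if j = i then p else (-(a j / a i)).val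
  have hc : ∀ j, a i * (c j : ZMod p) = if j = i then 0 else -a j := by
    intro j
    by_cases hj : j = i
    · simp [c, hj]
    · simp only [c, hj, if_false]
      push_cast
      rw [ZMod.natCast_zmod_val]
      field_simp
  have hM : ∀ w : Fin (n + 1) → ℤ,
      (updateRow (1 : Matrix (Fin (n + 1)) (Fin (n + 1)) ℤ) i c) *ᵥ w =
        Function.update w i (c ⬝ᵥ w) := by
    intro w
    ext j
    by_cases hj : j = i
    · subst hj; simp [mulVec]
    · rw [Function.update_of_ne hj, mulVec, updateRow_ne hj]
      exact congrFun (one_mulVec w) j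
  refine ⟨updateRow 1 i c, ?_, fun v => ⟨fun hv => ?_, ?_⟩⟩
  · have := Matrix.cramer_transpose_apply (1 : Matrix (Fin (n + 1)) (Fin (n + 1)) ℤ) c i
    rw [← this]
    simp [c]
  · have hdvd : (p : ℤ) ∣ v i - ∑ j ∈ Finset.univ.erase i, c j * v j := by
      rw [← ZMod.intCast_zmod_eq_zero_iff_dvd]
      refine (mul_eq_zero.1 (?_ : a i * _ = 0)).resolve_left hi'
      push_cast
      rw [mul_sub, Finset.mul_sum]
      have : ∑ j ∈ Finset.univ.erase i, a i * ((c j : ZMod p) * (v j : ZMod p)) =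
          ∑ j ∈ Finset.univ.erase i, -(a j * (v j : ZMod p)) := by
        refine Finset.sum_congr rfl fun j hj => ?_
        rw [← mul_assoc, hc, if_neg (Finset.ne_of_mem_erase hj), neg_mul]
      rw [this, Finset.sum_neg_distrib, sub_neg_eq_add,
        Finset.add_sum_erase _ (fun j => a j * (v j : ZMod p)) (Finset.mem_univ i)]
      exact hv
    obtain ⟨k, hk⟩ := hdvd
    refine ⟨Function.update v i k, ?_⟩
    rw [hM]
    ext j
    by_cases hj : j = i
    · subst hj
      rw [Function.update_self, dotProduct, ← Finset.add_sum_erase _ _ (Finset.mem_univ j)]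
      have : ∑ x ∈ Finset.univ.erase j, c x * Function.update v j k x =
          ∑ x ∈ Finset.univ.erase j, c x * v x :=
        Finset.sum_congr rfl fun x hx => by
          rw [Function.update_of_ne (Finset.ne_of_mem_erase hx)]
      rw [this, Function.update_self]
      simp only [c, if_true]
      linarith
    · simp [Function.update_of_ne hj]
  · rintro ⟨w, rfl⟩
    rw [hM, dotProduct, ← Finset.add_sum_erase _ _ (Finset.mem_univ i)]
    simp only [Function.update_self]
    have : ∑ x ∈ Finset.univ.erase i, a x * ((Function.update w i (c ⬝ᵥ w) x : ℤ) : ZMod p) =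
          ∑ x ∈ Finset.univ.erase i, a x * (w x : ZMod p) :=
        Finset.sum_congr rfl fun x hx => by
          rw [Function.update_of_ne (Finset.ne_of_mem_erase hx)]
    rw [this, dotProduct]
    push_cast
    rw [Finset.mul_sum, ← Finset.add_sum_erase _ _ (Finset.mem_univ i), ← mul_assoc, hc]
    simp only [if_true, zero_mul, zero_add]
    rw [← Finset.sum_add_distrib]
    refine Finset.sum_eq_zero fun x hx => ?_
    rw [← mul_assoc, hc, if_neg (Finset.ne_of_mem_erase hx)]
    ring

theorem IsCongruenceBasis.exists_eq_mul {n p : ℕ} (hp : p ≠ 0) {a : Fin (n + 1) → ZMod p}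
    {M N : Matrix (Fin (n + 1)) (Fin (n + 1)) ℤ} (hM : IsCongruenceBasis p a M)
    (hN : IsCongruenceBasis p a N) :
    ∃ γ : SpecialLinearGroup (Fin (n + 1)) ℤ, N = M * γ := by
  have : ∀ j, ∃ w, M *ᵥ w = N *ᵥ Pi.single j 1 := fun j =>
    (hM.2 _).1 ((hN.2 _).2 ⟨_, rfl⟩)
  choose w hw using this
  have hX : N = M * (Matrix.of w)ᵀ := by
    ext i j
    have := congrFun (hw j) i
    rw [mulVec_single_one] at this
    exact this.symm
  have hdet : (Matrix.of w)ᵀ.det = 1 := by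
    have h := congrArg Matrix.det hX
    rw [det_mul, hM.1, hN.1] at h
    have hp' : (p : ℤ) ≠ 0 := by exact_mod_cast hp
    exact mul_left_cancel₀ hp' (by rw [← h, mul_one])
  exact ⟨⟨_, hdet⟩, hX⟩

/-- The integer matrix `M` of determinant `p`, rescaled to have determinant one. -/
noncomputable def unimodularize {n : ℕ} {p : ℕ} (hp : p ≠ 0)
    (M : Matrix (Fin (n + 1)) (Fin (n + 1)) ℤ) (hM : M.det = p) : G n :=
  ⟨((p : ℝ) ^ ((n + 1 : ℕ) : ℝ)⁻¹)⁻¹ • M.map (Int.cast : ℤ → ℝ), by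
    have h : (M.map (Int.cast : ℤ → ℝ)).det = (p : ℝ) := by
      have := (Int.castRingHom ℝ).map_det M
      rw [hM] at this
      simpa using this.symm
    rw [det_smul, h, Fintype.card_fin, inv_pow, Real.rpow_inv_natCast_pow (by positivity) (by simp)]
    exact inv_mul_cancel₀ (by exact_mod_cast hp)⟩

/-- The point of the space of lattices given by the sublattice of `ℤ ^ (n + 1)` orthogonal to `a`
modulo `p`. -/
noncomputable def congruencePoint {n : ℕ} (p : ℕ) [hp : Fact p.Prime]
    (a : {a : Fin (n + 1) → ZMod p // a ≠ 0}) : G n ⧸ GammaSub n :=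
  (unimodularize hp.out.ne_zero _ (exists_isCongruenceBasis p a.1 a.2).choose_spec.1 : G n)

theorem congruencePoint_eq {n : ℕ} {p : ℕ} [hp : Fact p.Prime]
    (a : {a : Fin (n + 1) → ZMod p // a ≠ 0}) {M : Matrix (Fin (n + 1)) (Fin (n + 1)) ℤ}
    (hM : IsCongruenceBasis p a.1 M) :
    congruencePoint p a = (unimodularize hp.out.ne_zero M hM.1 : G n) := by
  obtain ⟨γ, hγ⟩ := (exists_isCongruenceBasis p a.1 a.2).choose_spec.exists_eq_mul
    hp.out.ne_zero hM
  rw [congruencePoint, QuotientGroup.eq]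
  refine ⟨γ, ?_⟩
  rw [eq_inv_mul_iff_mul_eq]
  refine Subtype.ext ?_
  change (_ • Matrix.map _ _) * γ.1.map (Int.castRingHom ℝ) = _ • Matrix.map _ _
  rw [smul_mul_assoc, hγ]
  congr 1
  exact (Matrix.map_mul (f := Int.castRingHom ℝ)).symm

theorem exists_equiv_smul_congruencePoint {n : ℕ} (p : ℕ) [hp : Fact p.Prime] (γ : G n)
    (hγ : γ ∈ GammaSub n) :
    ∃ e : {a : Fin (n + 1) → ZMod p // a ≠ 0} ≃ {a : Fin (n + 1) → ZMod p // a ≠ 0},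
      ∀ a, γ • congruencePoint p a = congruencePoint p (e a) := by
  obtain ⟨δ, rfl⟩ := hγ
  let φ : SpecialLinearGroup (Fin (n + 1)) ℤ →* SpecialLinearGroup (Fin (n + 1)) (ZMod p) :=
    SpecialLinearGroup.map (Int.castRingHom (ZMod p))
  have hcancel : ∀ (x y : SpecialLinearGroup (Fin (n + 1)) (ZMod p)), x * y = 1 →
      ∀ a : Fin (n + 1) → ZMod p, (a ᵥ* x.1) ᵥ* y.1 = a := by
    intro x y hxy a
    exact (vecMul_vecMul a _ _).trans ((congrArg (fun z => a ᵥ* z.1) hxy).trans (vecMul_one a))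
  have hne : ∀ (x : SpecialLinearGroup (Fin (n + 1)) (ZMod p)) (a : Fin (n + 1) → ZMod p),
      a ≠ 0 → a ᵥ* x.1 ≠ 0 := by
    intro x a ha h
    apply ha
    rw [← hcancel x x⁻¹ (mul_inv_cancel x) a, h, zero_vecMul]
  let e : {a : Fin (n + 1) → ZMod p // a ≠ 0} ≃ {a : Fin (n + 1) → ZMod p // a ≠ 0} :=
    { toFun := fun a => ⟨_, hne (φ δ)⁻¹ a.1 a.2⟩
      invFun := fun a => ⟨_, hne (φ δ) a.1 a.2⟩
      left_inv := fun a => Subtype.ext (hcancel _ _ (inv_mul_cancel _) a.1)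
      right_inv := fun a => Subtype.ext (hcancel _ _ (mul_inv_cancel _) a.1) }
  refine ⟨e, fun a => ?_⟩
  obtain ⟨M, hM⟩ := exists_isCongruenceBasis p a.1 a.2
  have hcast : ∀ (η : SpecialLinearGroup (Fin (n + 1)) ℤ) (v : Fin (n + 1) → ℤ),
      (φ η).1 *ᵥ (fun i => (v i : ZMod p)) =
        fun i => ((η.1 *ᵥ v) i : ZMod p) := by
    intro η v
    ext i
    simp [φ, mulVec, dotProduct]
  have hM' : IsCongruenceBasis p (e a).1 (δ.1 * M) := by
    refine ⟨by rw [det_mul, δ.2, one_mul, hM.1], fun v => ?_⟩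
    change (a.1 ᵥ* (φ δ)⁻¹.1) ⬝ᵥ _ = 0 ↔ _
    rw [← dotProduct_mulVec, ← map_inv, hcast, hM.2]
    refine exists_congr fun w => ?_
    rw [← mulVec_mulVec]
    constructor
    · intro h
      rw [h]
      exact mulVec_mulVec_of_mul_eq_one (mul_inv_cancel δ) v
    · intro h
      rw [← h]
      exact (mulVec_mulVec_of_mul_eq_one (inv_mul_cancel δ) _).symm
  rw [congruencePoint_eq a hM, congruencePoint_eq (e a) hM', MulAction.Quotient.smul_coe,
    smul_eq_mul]
  congr 1
  refine Subtype.ext ?_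
  change δ.1.map (Int.castRingHom ℝ) * (_ • Matrix.map _ _) = _ • Matrix.map _ _
  rw [mul_smul_comm]
  congr 1
  exact (Matrix.map_mul (f := Int.castRingHom ℝ)).symm

theorem card_orthogonal {n : ℕ} (p : ℕ) [hp : Fact p.Prime] (v : Fin (n + 1) → ZMod p)
    (hv : v ≠ 0) :
    Nat.card {a : {a : Fin (n + 1) → ZMod p // a ≠ 0} // a.1 ⬝ᵥ v = 0} = p ^ n - 1 := by
  obtain ⟨i, hi⟩ := Function.ne_iff.1 hv
  have hi' : v i ≠ 0 := hi
  let f : (Fin (n + 1) → ZMod p) →ₗ[ZMod p] ZMod p := (dotProductBilin (ZMod p) (ZMod p)).flip v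
  have hf : ∀ a, f a = a ⬝ᵥ v := fun a => rfl
  have hsurj : Function.Surjective f := fun c =>
    ⟨Pi.single i (c / v i), by rw [hf, single_dotProduct]; field_simp⟩
  have hcard : Nat.card (LinearMap.ker f) = p ^ n := by
    have h := Submodule.card_eq_card_quotient_mul_card (LinearMap.ker f)
    rw [Nat.card_congr (f.quotKerEquivOfSurjective hsurj).toEquiv] at h
    rw [Nat.card_fun, Nat.card_zmod, Nat.card_fin, pow_succ, mul_comm, mul_comm _ p] at h
    exact (Nat.eq_of_mul_eq_mul_left hp.out.pos h).symm
  let e : {a : {a : Fin (n + 1) → ZMod p // a ≠ 0} // a.1 ⬝ᵥ v = 0} ≃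
      {a : LinearMap.ker f // a ≠ 0} :=
    { toFun := fun a => ⟨⟨a.1.1, a.2⟩, fun h => a.1.2 (congrArg Subtype.val h)⟩
      invFun := fun a => ⟨⟨a.1.1, fun h => a.2 (Subtype.ext h)⟩, a.1.2⟩
      left_inv := fun a => rfl
      right_inv := fun a => rfl }
  rw [Nat.card_congr e, ← hcard]
  classical
  have := Fintype.ofFinite (LinearMap.ker f)
  rw [Nat.card_eq_fintype_card, Nat.card_eq_fintype_card, Fintype.card_subtype_compl,
    Fintype.card_subtype_eq]

end HeckePoints

section HeckeConvergence

open scoped ENNReal Topology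
open Filter

/-- The set of integer vectors `v` with `g (r⁻¹ v) ∈ C`. -/
def scaledPoints {n : ℕ} (g : G n) (C : Set (Fin (n + 1) → ℝ)) (r : ℝ) :
    Set (Fin (n + 1) → ℤ) :=
  {v | (g : Matrix (Fin (n + 1)) (Fin (n + 1)) ℝ) *ᵥ (r⁻¹ • fun i => (v i : ℝ)) ∈ C}

/-- The linear map given by an element of `G n`. -/
noncomputable def linearMapOfG {n : ℕ} (g : G n) : (Fin (n + 1) → ℝ) →ₗ[ℝ] (Fin (n + 1) → ℝ) :=
  Matrix.toLin' (g : Matrix (Fin (n + 1)) (Fin (n + 1)) ℝ)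

theorem volume_preimage_linearMapOfG {n : ℕ} (g : G n) (C : Set (Fin (n + 1) → ℝ)) :
    volume (linearMapOfG g ⁻¹' C) = volume C := by
  have h : LinearMap.det (linearMapOfG g) = 1 := (LinearMap.det_toLin' _).trans g.2
  rw [Measure.addHaar_preimage_linearMap _ (by rw [h]; exact one_ne_zero), h]
  simp

theorem isBounded_preimage_linearMapOfG {n : ℕ} (g : G n) {C : Set (Fin (n + 1) → ℝ)}
    (hC : Bornology.IsBounded C) : Bornology.IsBounded (linearMapOfG g ⁻¹' C) := by
  have h : linearMapOfG g ⁻¹' C ⊆ (linearMapOfG g⁻¹).toContinuousLinearMap '' C := fun x hx =>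
    ⟨_, hx, mulVec_mulVec_of_mul_eq_one (inv_mul_cancel g) x⟩
  exact ((linearMapOfG g⁻¹).toContinuousLinearMap.lipschitz.isBounded_image hC).subset h

theorem mem_scaledPoints_iff {n : ℕ} (g : G n) (C : Set (Fin (n + 1) → ℝ)) (r : ℝ)
    (v : Fin (n + 1) → ℤ) :
    v ∈ scaledPoints g C r ↔ (r⁻¹ • fun i => (v i : ℝ)) ∈ linearMapOfG g ⁻¹' C := Iff.rfl

theorem exists_abs_le_of_mem_scaledPoints {n : ℕ} (g : G n) {C : Set (Fin (n + 1) → ℝ)}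
    (hC : Bornology.IsBounded C) :
    ∃ R : ℝ, ∀ r > 0, ∀ v ∈ scaledPoints g C r, ∀ i, |(v i : ℝ)| ≤ R * r := by
  obtain ⟨R, hR⟩ := (isBounded_preimage_linearMapOfG g hC).exists_norm_le
  refine ⟨R, fun r hr v hv i => ?_⟩
  have := (norm_le_pi_norm _ i).trans (hR _ hv)
  rw [Pi.smul_apply, smul_eq_mul, Real.norm_eq_abs, abs_mul, abs_inv, abs_of_pos hr,
    inv_mul_le_iff₀ hr] at this
  linarith

theorem finite_scaledPoints {n : ℕ} (g : G n) {C : Set (Fin (n + 1) → ℝ)}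
    (hC : Bornology.IsBounded C) {r : ℝ} (hr : 0 < r) : (scaledPoints g C r).Finite := by
  obtain ⟨R, hR⟩ := exists_abs_le_of_mem_scaledPoints g hC
  refine (Set.finite_Icc (fun _ => -⌈R * r⌉ : Fin (n + 1) → ℤ) (fun _ => ⌈R * r⌉)).subset
    fun v hv => ?_
  have h : ∀ i, |v i| ≤ ⌈R * r⌉ := fun i => by
    have := (hR r hr v hv i).trans (Int.le_ceil _)
    exact_mod_cast this
  exact ⟨fun i => (abs_le.1 (h i)).1, fun i => (abs_le.1 (h i)).2⟩

theorem card_preimage_inter_smul_span {n : ℕ} (g : G n) (C : Set (Fin (n + 1) → ℝ)) {r : ℝ}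
    (hr : 0 < r) :
    Nat.card ↑((linearMapOfG g ⁻¹' C) ∩
      r⁻¹ • (Submodule.span ℤ (Set.range (Pi.basisFun ℝ (Fin (n + 1)))) :
        Set (Fin (n + 1) → ℝ))) = (scaledPoints g C r).ncard := by
  let f : (Fin (n + 1) → ℤ) → (Fin (n + 1) → ℝ) := fun v => r⁻¹ • fun i => (v i : ℝ)
  have hf : Function.Injective f := fun v w h => by
    have h' := smul_right_injective _ (inv_ne_zero hr.ne') h
    ext i
    exact_mod_cast congrFun h' i
  rw [Nat.card_coe_set_eq, ← Set.ncard_image_of_injective _ hf]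
  congr 1
  ext x
  constructor
  · rintro ⟨hx, y, hy, rfl⟩
    have hy' := (Module.Basis.mem_span_iff_repr_mem ℤ (Pi.basisFun ℝ (Fin (n + 1))) y).1 hy
    choose w hw using hy'
    have : y = fun i => (w i : ℝ) := by
      ext i
      simpa using (hw i).symm
    subst this
    exact ⟨w, hx, rfl⟩
  · rintro ⟨w, hw, rfl⟩
    refine ⟨hw, _, ?_, rfl⟩
    refine (Module.Basis.mem_span_iff_repr_mem ℤ (Pi.basisFun ℝ (Fin (n + 1))) _).2 fun i => ?_
    exact ⟨w i, by simp⟩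

theorem tendsto_ncard_scaledPoints {n : ℕ} (g : G n) {C : Set (Fin (n + 1) → ℝ)}
    (hCb : Bornology.IsBounded C) (hCc : Convex ℝ C) (hCm : MeasurableSet C) (hC0 : 0 ∈ C) :
    Tendsto (fun r : ℝ => ((scaledPoints g C r).ncard : ℝ) / r ^ (n + 1)) atTop
      (𝓝 (volume.real C)) := by
  have hconv : Convex ℝ (linearMapOfG g ⁻¹' C) := hCc.linear_preimage _
  have h := tendsto_card_div_pow_atTop_volume' (linearMapOfG g ⁻¹' C)
    (isBounded_preimage_linearMapOfG g hCb)
    (hCm.preimage (linearMapOfG g).continuous_of_finiteDimensional.measurable)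
    (hconv.addHaar_frontier _) ?_
  · rw [Measure.real, volume_preimage_linearMapOfG, Fintype.card_fin] at h
    refine h.congr' ?_
    filter_upwards [eventually_gt_atTop 0] with r hr
    rw [card_preimage_inter_smul_span g C hr]
  · rintro x y hx hxy _ ⟨z, hz, rfl⟩
    have hy : 0 < y := hx.trans_le hxy
    refine ⟨(x / y) • z, hconv.smul_mem_of_zero_mem ?_ hz
      ⟨by positivity, (div_le_one hy).2 hxy⟩, ?_⟩
    · simpa using hC0
    · simp only [smul_smul]
      rw [mul_div_cancel₀ _ hy.ne']

theorem latticeMeasure_smul_congruencePoint {n p : ℕ} [hp : Fact p.Prime] (g : G n)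
    (a : {a : Fin (n + 1) → ZMod p // a ≠ 0}) {C : Set (Fin (n + 1) → ℝ)} (hC : MeasurableSet C) :
    latticeMeasure {0}ᶜ (g • congruencePoint p a) C =
      ∑' v : Fin (n + 1) → ℤ, {v : Fin (n + 1) → ℤ | v ≠ 0 ∧ a.1 ⬝ᵥ (fun i => (v i : ZMod p)) = 0 ∧
        v ∈ scaledPoints g C ((p : ℝ) ^ ((n + 1 : ℕ) : ℝ)⁻¹)}.indicator 1 v := by
  obtain ⟨M, hM⟩ := exists_isCongruenceBasis p a.1 a.2
  have hdet : M.det ≠ 0 := by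
    rw [hM.1]
    exact_mod_cast hp.out.ne_zero
  rw [congruencePoint_eq a hM, MulAction.Quotient.smul_coe, smul_eq_mul, latticeMeasure_mk_apply
    (fun γ v => mulVec_ne_zero_of_specialLinearGroup γ v) _ hC]
  let φ : ({0}ᶜ : Set (Fin (n + 1) → ℤ)) → (Fin (n + 1) → ℤ) := fun w => M *ᵥ w.1
  have hφ : Function.Injective φ := fun v w h => by
    refine Subtype.ext (sub_eq_zero.1 (eq_zero_of_mulVec_eq_zero hdet ?_))
    rw [mulVec_sub]
    exact sub_eq_zero.2 h
  rw [← hφ.tsum_eq]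
  · refine tsum_congr fun w => ?_
    have h1 : φ w ≠ 0 := fun h => w.2 (eq_zero_of_mulVec_eq_zero hdet h)
    have h2 := (hM.2 (φ w)).2 ⟨w, rfl⟩
    have h3 : (g * unimodularize hp.out.ne_zero M hM.1).1 *ᵥ (fun i => ((w.1 i : ℤ) : ℝ)) =
        g.1 *ᵥ (((p : ℝ) ^ ((n + 1 : ℕ) : ℝ)⁻¹)⁻¹ • fun i => ((φ w i : ℤ) : ℝ)) := by
      refine (mulVec_mulVec _ _ _).symm.trans ?_
      refine congrArg (fun z => g.1 *ᵥ z) ?_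
      refine (smul_mulVec _ _ _).trans ?_
      rw [mulVec_intCast]
    have h4 : (g * unimodularize hp.out.ne_zero M hM.1).1 *ᵥ (fun i => ((w.1 i : ℤ) : ℝ)) ∈ C ↔
        φ w ∈ scaledPoints g C ((p : ℝ) ^ ((n + 1 : ℕ) : ℝ)⁻¹) := by
      rw [h3]
      rfl
    by_cases h : φ w ∈ scaledPoints g C ((p : ℝ) ^ ((n + 1 : ℕ) : ℝ)⁻¹)
    · exact (Set.indicator_of_mem (h4.2 h) _).trans
        (Set.indicator_of_mem (s := {v : Fin (n + 1) → ℤ | v ≠ 0 ∧ _ ∧ _}) ⟨h1, h2, h⟩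
          (1 : (Fin (n + 1) → ℤ) → ℝ≥0∞)).symm
    · exact (Set.indicator_of_notMem (fun h' => h (h4.1 h')) _).trans
        (Set.indicator_of_notMem (s := {v : Fin (n + 1) → ℤ | v ≠ 0 ∧ _ ∧ _})
          (fun h' => h h'.2.2) (1 : (Fin (n + 1) → ℤ) → ℝ≥0∞)).symm
  · intro v hv
    obtain ⟨h1, h2, -⟩ := Set.mem_of_indicator_ne_zero hv
    obtain ⟨w, hw⟩ := (hM.2 v).1 h2
    refine ⟨⟨w, ?_⟩, hw⟩
    rintro rfl
    exact h1 (hw ▸ mulVec_zero M)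

theorem sum_latticeMeasure_smul_congruencePoint {n p : ℕ} [hp : Fact p.Prime] (g : G n)
    {C : Set (Fin (n + 1) → ℝ)} (hC : MeasurableSet C) (hC0 : 0 ∈ C)
    (hfin : (scaledPoints g C ((p : ℝ) ^ ((n + 1 : ℕ) : ℝ)⁻¹)).Finite)
    (hmod : ∀ v ∈ scaledPoints g C ((p : ℝ) ^ ((n + 1 : ℕ) : ℝ)⁻¹), v ≠ 0 →
      (fun i => (v i : ZMod p)) ≠ 0) :
    ∑ a, latticeMeasure {0}ᶜ (g • congruencePoint p a) C =
      ((p ^ n - 1 : ℕ) : ℝ≥0∞) *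
        (((scaledPoints g C ((p : ℝ) ^ ((n + 1 : ℕ) : ℝ)⁻¹)).ncard - 1 : ℕ) : ℝ≥0∞) := by
  set S := scaledPoints g C ((p : ℝ) ^ ((n + 1 : ℕ) : ℝ)⁻¹)
  have h0 : (0 : Fin (n + 1) → ℤ) ∈ S := by
    have h : ((((p : ℝ) ^ ((n + 1 : ℕ) : ℝ)⁻¹)⁻¹) • fun i =>
        (((0 : Fin (n + 1) → ℤ) i : ℤ) : ℝ)) = 0 := by
      ext i
      simp
    rw [mem_scaledPoints_iff, h, Set.mem_preimage, map_zero]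
    exact hC0
  simp_rw [latticeMeasure_smul_congruencePoint g _ hC]
  rw [← Summable.tsum_finsetSum fun _ _ => ENNReal.summable]
  have key : ∀ v : Fin (n + 1) → ℤ, ∑ a : {a : Fin (n + 1) → ZMod p // a ≠ 0},
      {v : Fin (n + 1) → ℤ | v ≠ 0 ∧ a.1 ⬝ᵥ (fun i => (v i : ZMod p)) = 0 ∧ v ∈ S}.indicator
        (1 : (Fin (n + 1) → ℤ) → ℝ≥0∞) v =
      ((p ^ n - 1 : ℕ) : ℝ≥0∞) * (S \ {0}).indicator 1 v := by
    classical
    intro v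
    by_cases hv : v ∈ S \ {0}
    · have h2 : v ≠ 0 := hv.2
      rw [Set.indicator_of_mem hv, ← card_orthogonal p _ (hmod v hv.1 hv.2)]
      simp only [Set.indicator_apply, Set.mem_ofPred_eq, h2, hv.1, ne_eq, not_false_eq_true,
        true_and, and_true, Pi.one_apply, Finset.sum_boole, mul_one]
      rw [Nat.card_eq_fintype_card, Fintype.card_subtype]
    · rw [Set.indicator_of_notMem hv, mul_zero]
      refine Finset.sum_eq_zero fun a _ => Set.indicator_of_notMem (fun h => hv ⟨h.2.2, h.1⟩) _
  rw [tsum_congr key, ENNReal.tsum_mul_left, ← tsum_subtype]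
  simp only [Pi.one_apply]
  rw [ENNReal.tsum_set_one, ← hfin.sdiff.cast_ncard_eq, Set.ncard_sdiff_singleton_of_mem h0]
  rfl

theorem card_ne_zero_subtype (n p : ℕ) [hp : Fact p.Prime] :
    Fintype.card {a : Fin (n + 1) → ZMod p // a ≠ 0} = p ^ (n + 1) - 1 := by
  rw [Fintype.card_subtype_compl, Fintype.card_subtype_eq, Fintype.card_fun, ZMod.card,
    Fintype.card_fin]

theorem tendsto_lintegral_averageKernel_congruencePoint {n : ℕ} (hn : 1 ≤ n) {p : ℕ → ℕ}
    [hp : ∀ k, Fact (p k).Prime] (hlim : Tendsto p atTop atTop) (g : G n)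
    {C : Set (Fin (n + 1) → ℝ)} (hCb : Bornology.IsBounded C) (hCc : Convex ℝ C)
    (hCm : MeasurableSet C) (hC0 : 0 ∈ C) :
    Tendsto (fun k => ∫⁻ y, latticeMeasure {0}ᶜ y C
      ∂averageKernel (congruencePoint (p k)) (g : G n ⧸ GammaSub n)) atTop (𝓝 (volume C)) := by
  let r : ℕ → ℝ := fun k => (p k : ℝ) ^ ((n + 1 : ℕ) : ℝ)⁻¹
  have hplim : Tendsto (fun k => (p k : ℝ)) atTop atTop := tendsto_natCast_atTop_atTop.comp hlim
  have hr : Tendsto r atTop atTop :=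
    (tendsto_rpow_atTop (inv_pos.2 (by positivity))).comp hplim
  have hrpow : ∀ k, r k ^ (n + 1) = p k := fun k =>
    Real.rpow_inv_natCast_pow (by positivity) (by simp)
  have hreal : Tendsto (fun k => ((p k : ℝ) ^ n - 1) * (((scaledPoints g C (r k)).ncard : ℝ) - 1) /
      ((p k : ℝ) ^ (n + 1) - 1)) atTop (𝓝 (volume.real C)) := by
    have h1 := (tendsto_ncard_scaledPoints g hCb hCc hCm hC0).comp hr
    have hinv := tendsto_inv_atTop_zero.comp hplim
    have h2 : Tendsto (fun k => (1 - ((p k : ℝ)⁻¹) ^ n) / (1 - ((p k : ℝ)⁻¹) ^ (n + 1))) atTop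
        (𝓝 ((1 - 0 ^ n) / (1 - 0 ^ (n + 1)))) :=
      Tendsto.div (tendsto_const_nhds.sub (hinv.pow n)) (tendsto_const_nhds.sub (hinv.pow _))
        (by simp)
    have h3 := h2.mul (h1.sub hinv)
    simp only [ne_eq, Nat.one_le_iff_ne_zero.1 hn, not_false_eq_true, zero_pow, Nat.add_eq_zero_iff,
      one_ne_zero, and_false, sub_zero, div_one, one_mul] at h3
    refine h3.congr fun k => ?_
    have hp1 : (1 : ℝ) < p k := by exact_mod_cast (hp k).out.one_lt
    have hp0 : (p k : ℝ) ≠ 0 := by positivity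
    have hne : (p k : ℝ) ^ (n + 1) - 1 ≠ 0 := (sub_pos.2 (one_lt_pow₀ hp1 (by simp))).ne'
    simp only [Function.comp_apply, hrpow, inv_pow]
    have hne' : 1 - ((p k : ℝ) ^ (n + 1))⁻¹ ≠ 0 := by
      have : 1 - ((p k : ℝ) ^ (n + 1))⁻¹ = ((p k : ℝ) ^ (n + 1) - 1) / (p k : ℝ) ^ (n + 1) := by
        field_simp
      rw [this]
      positivity
    rw [div_mul_eq_mul_div, div_eq_div_iff hne' hne]
    field_simp
    ring
  have hC : volume C ≠ ∞ := hCb.measure_lt_top.ne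
  rw [← ENNReal.ofReal_toReal hC]
  refine (ENNReal.tendsto_ofReal hreal).congr' ?_
  obtain ⟨R, hR⟩ := exists_abs_le_of_mem_scaledPoints g hCb
  filter_upwards [hr.eventually_gt_atTop (max R 1)] with k hk
  have hk1 : 1 < r k := (le_max_right _ _).trans_lt hk
  have hkR : R < r k := (le_max_left _ _).trans_lt hk
  have hk0 : 0 < r k := by linarith
  have hfin := finite_scaledPoints g hCb hk0
  have hmod : ∀ v ∈ scaledPoints g C (r k), v ≠ 0 → (fun i => (v i : ZMod (p k))) ≠ 0 := by
    intro v hv hv0 h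
    obtain ⟨i, hi⟩ := Function.ne_iff.1 hv0
    have hdvd := (ZMod.intCast_zmod_eq_zero_iff_dvd _ _).1 (congrFun h i)
    have h1 : (p k : ℤ) ≤ |v i| := Int.le_of_dvd (abs_pos.2 hi) ((dvd_abs _ _).2 hdvd)
    have h2 : (p k : ℝ) ≤ |(v i : ℝ)| := by exact_mod_cast h1
    have h3 : r k * r k ≤ r k ^ (n + 1) := by
      rw [← pow_two]
      exact pow_le_pow_right₀ hk1.le (by omega)
    have h4 := hR _ hk0 v hv i
    have h5 : R * r k < r k * r k := mul_lt_mul_of_pos_right hkR hk0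
    rw [hrpow] at h3
    linarith
  have hmeas : Measurable fun y : G n ⧸ GammaSub n => latticeMeasure {0}ᶜ y C :=
    (Measure.measurable_coe hCm).comp
      (measurable_latticeMeasure fun γ v => mulVec_ne_zero_of_specialLinearGroup γ v)
  rw [lintegral_averageKernel_mk (exists_equiv_smul_congruencePoint (p k)) g hmeas,
    sum_latticeMeasure_smul_congruencePoint g hCm hC0 hfin hmod, card_ne_zero_subtype]
  have h0 : (0 : Fin (n + 1) → ℤ) ∈ scaledPoints g C (r k) := by
    have h : ((r k)⁻¹ • fun i => (((0 : Fin (n + 1) → ℤ) i : ℤ) : ℝ)) = 0 := by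
      ext i
      simp
    rw [mem_scaledPoints_iff, h, Set.mem_preimage, map_zero]
    exact hC0
  have hN : 1 ≤ (scaledPoints g C (r k)).ncard := (Set.ncard_pos hfin).2 ⟨0, h0⟩
  have hpn : ∀ m, 1 ≤ p k ^ m := fun m => Nat.one_le_pow _ _ (hp k).out.pos
  have hcast : ∀ m : ℕ, 1 ≤ m → ((m : ℝ) - 1) = ((m - 1 : ℕ) : ℝ) := fun m hm => by
    rw [Nat.cast_sub hm, Nat.cast_one]
  have hpos : 0 < p k ^ (n + 1) - 1 := Nat.sub_pos_of_lt (Nat.one_lt_pow (by simp) (hp k).out.one_lt)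
  have e1 := hcast _ (hpn n)
  have e2 := hcast _ (hpn (n + 1))
  push_cast at e1 e2
  rw [hcast _ hN, e1, e2, ENNReal.ofReal_div_of_pos (by exact_mod_cast hpos),
    ENNReal.ofReal_mul (by positivity), ENNReal.ofReal_natCast, ENNReal.ofReal_natCast,
    ENNReal.ofReal_natCast, ENNReal.div_eq_inv_mul]

end HeckeConvergence

section MeanValue

open scoped ENNReal Topology
open Filter

theorem lintegral_latticeMeasure_of_convex {n : ℕ} (hn : 1 ≤ n)
    (μ : Measure (G n ⧸ GammaSub n)) [IsProbabilityMeasure μ]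
    (hinv : ∀ g : G n, MeasurePreserving (fun x => g • x) μ μ) {C : Set (Fin (n + 1) → ℝ)}
    (hCb : Bornology.IsBounded C) (hCc : Convex ℝ C) (hCm : MeasurableSet C) (hC0 : 0 ∈ C) :
    ∫⁻ x, latticeMeasure {0}ᶜ x C ∂μ = volume C := by
  let p : ℕ → ℕ := Nat.nth Nat.Prime
  have hp : ∀ k, Fact (p k).Prime := fun k => ⟨Nat.prime_nth_prime k⟩
  have hlim : Tendsto p atTop atTop :=
    (Nat.nth_strictMono Nat.infinite_setOfPred_prime).tendsto_atTop
  have : ∀ k, Nonempty {a : Fin (n + 1) → ZMod (p k) // a ≠ 0} := fun k =>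
    ⟨⟨fun _ => 1, fun h => one_ne_zero (congrFun h 0)⟩⟩
  let N : G n ⧸ GammaSub n → ℝ≥0∞ := fun x => latticeMeasure {0}ᶜ x C
  have hN : Measurable N := (Measure.measurable_coe hCm).comp
    (measurable_latticeMeasure fun γ v => mulVec_ne_zero_of_specialLinearGroup γ v)
  let K : ℕ → G n ⧸ GammaSub n → Measure (G n ⧸ GammaSub n) := fun k =>
    averageKernel (congruencePoint (p k))
  have hKm : ∀ {f : G n ⧸ GammaSub n → ℝ≥0∞}, Measurable f → ∀ k,
      Measurable fun x => ∫⁻ y, f y ∂K k x := fun hf k =>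
    (Measure.measurable_lintegral hf).comp
      (measurable_averageKernel (exists_equiv_smul_congruencePoint (p k)))
  have hK : ∀ {f : G n ⧸ GammaSub n → ℝ≥0∞}, Measurable f → ∀ k,
      ∫⁻ x, ∫⁻ y, f y ∂K k x ∂μ = ∫⁻ x, f x ∂μ := fun hf k =>
    lintegral_lintegral_averageKernel (finite_GammaSub_inter_isCompact n) μ hinv
      (exists_equiv_smul_congruencePoint (p k)) hf
  have hconv : ∀ x, Tendsto (fun k => ∫⁻ y, N y ∂K k x) atTop (𝓝 (volume C)) := fun x => by
    induction x using QuotientGroup.induction_on with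
    | H g => exact tendsto_lintegral_averageKernel_congruencePoint hn hlim g hCb hCc hCm hC0
  refine le_antisymm ?_ ?_
  · have htrunc : ∀ M : ℕ, ∫⁻ x, min (N x) M ∂μ ≤ volume C := by
      intro M
      have hle : ∀ k x, ∫⁻ y, min (N y) M ∂K k x ≤ min (∫⁻ y, N y ∂K k x) M := by
        intro k x
        refine le_min (lintegral_mono fun y => min_le_left _ _)
          ((lintegral_mono fun y => min_le_right _ _).trans ?_)
        induction x using QuotientGroup.induction_on with
        | H g =>
          refine (lintegral_averageKernel_mk (exists_equiv_smul_congruencePoint (p k)) g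
            measurable_const).trans_le ?_
          rw [Finset.sum_const, Finset.card_univ, nsmul_eq_mul, ← mul_assoc]
          exact (mul_le_mul_left (ENNReal.inv_mul_le_one _) _).trans_eq (one_mul _)
      have hlim' : Tendsto (fun k => ∫⁻ x, min (∫⁻ y, N y ∂K k x) M ∂μ) atTop
          (𝓝 (∫⁻ _, min (volume C) M ∂μ)) :=
        tendsto_lintegral_of_dominated_convergence (fun _ => (M : ℝ≥0∞))
          (fun k => (hKm hN k).min measurable_const)
          (fun k => .of_forall fun x => min_le_right _ _) (by simp)
          (.of_forall fun x => (hconv x).min tendsto_const_nhds)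
      rw [lintegral_const, measure_univ, mul_one] at hlim'
      refine (ge_of_tendsto' hlim' fun k => ?_).trans (min_le_left _ _)
      rw [← hK (hN.min measurable_const) k]
      exact lintegral_mono (hle k)
    have hsup : ∀ x, N x = ⨆ M : ℕ, min (N x) M := fun x => by
      rw [← inf_iSup_eq, ENNReal.iSup_natCast, inf_top_eq]
    change ∫⁻ x, N x ∂μ ≤ _
    rw [lintegral_congr hsup, lintegral_iSup (fun M => hN.min measurable_const)]
    · exact iSup_le htrunc
    · exact fun i j hij x => min_le_min_left _ (by exact_mod_cast hij)
  · calc volume C = ∫⁻ x, liminf (fun k => ∫⁻ y, N y ∂K k x) atTop ∂μ := by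
          simp_rw [fun x => (hconv x).liminf_eq]
          rw [lintegral_const, measure_univ, mul_one]
      _ ≤ liminf (fun k => ∫⁻ x, ∫⁻ y, N y ∂K k x ∂μ) atTop := lintegral_liminf_le (hKm hN)
      _ = ∫⁻ x, N x ∂μ := by
          simp_rw [hK hN]
          exact liminf_const _

/-- The bounded measurable convex sets of reals which contain zero. -/
def boundedConvexNhd : Set (Set ℝ) :=
  {s | MeasurableSet s ∧ Convex ℝ s ∧ Bornology.IsBounded s ∧ 0 ∈ s}

theorem isPiSystem_boundedConvexNhd : IsPiSystem boundedConvexNhd :=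
  fun _ hs _ ht _ => ⟨hs.1.inter ht.1, hs.2.1.inter ht.2.1, hs.2.2.1.subset Set.inter_subset_left,
    hs.2.2.2, ht.2.2.2⟩

theorem generateFrom_boundedConvexNhd :
    MeasurableSpace.generateFrom boundedConvexNhd = Real.measurableSpace := by
  refine le_antisymm (MeasurableSpace.generateFrom_le fun s hs => hs.1) ?_
  rw [BorelSpace.measurable_eq (α := ℝ), borel_eq_generateFrom_Ici]
  refine MeasurableSpace.generateFrom_le ?_
  rintro _ ⟨b, rfl⟩
  rcases le_or_gt b 0 with hb | hb
  · have : Set.Ici b = ⋃ m : ℕ, Set.Icc b m := by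
      ext x
      simp only [Set.mem_Ici, Set.mem_iUnion, Set.mem_Icc, exists_and_left, iff_self_and]
      exact fun _ => exists_nat_ge x
    rw [this]
    refine MeasurableSet.iUnion fun m => MeasurableSpace.measurableSet_generateFrom ?_
    exact ⟨measurableSet_Icc, convex_Icc _ _, Metric.isBounded_Icc _ _, hb, by positivity⟩
  · have : Set.Ici b = (⋃ m : ℕ, Set.Ioo (-(m + 1 : ℝ)) b)ᶜ := by
      ext x
      simp only [Set.mem_Ici, Set.mem_compl_iff, Set.mem_iUnion, Set.mem_Ioo, not_exists, not_and,
        not_lt]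
      refine ⟨fun h _ _ => h, fun h => ?_⟩
      obtain ⟨m, hm⟩ := exists_nat_ge (-x)
      exact h m (by linarith)
    rw [this]
    refine (MeasurableSet.iUnion fun m => MeasurableSpace.measurableSet_generateFrom ?_).compl
    exact ⟨measurableSet_Ioo, convex_Ioo _ _, Metric.isBounded_Ioo _ _,
      by rw [neg_lt_zero]; positivity, hb⟩

theorem bind_latticeMeasure_ne_zero {n : ℕ} (hn : 1 ≤ n)
    (μ : Measure (G n ⧸ GammaSub n)) [IsProbabilityMeasure μ]
    (hinv : ∀ g : G n, MeasurePreserving (fun x => g • x) μ μ) :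
    μ.bind (latticeMeasure {0}ᶜ) = volume := by
  have hmeas : Measurable (latticeMeasure (n := n) {0}ᶜ) :=
    measurable_latticeMeasure fun γ v => mulVec_ne_zero_of_specialLinearGroup γ v
  rw [volume_pi]
  refine (Measure.pi_eq_generateFrom (C := fun _ => boundedConvexNhd)
    (fun _ => generateFrom_boundedConvexNhd) (fun _ => isPiSystem_boundedConvexNhd)
    (fun _ => ⟨fun m : ℕ => Set.Icc (-m : ℝ) m, fun m => ⟨measurableSet_Icc, convex_Icc _ _,
      Metric.isBounded_Icc _ _, by simp, by simp⟩, fun m => isCompact_Icc.measure_lt_top, ?_⟩)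
    fun s hs => ?_).symm
  · refine Set.eq_univ_of_forall fun x => ?_
    obtain ⟨m, hm⟩ := exists_nat_ge |x|
    exact Set.mem_iUnion.2 ⟨m, abs_le.1 hm⟩
  · have hsm : MeasurableSet (Set.univ.pi s) := MeasurableSet.univ_pi fun i => (hs i).1
    rw [Measure.bind_apply hsm hmeas.aemeasurable, lintegral_latticeMeasure_of_convex hn μ hinv
      (Bornology.IsBounded.pi fun i => (hs i).2.2.1) (convex_pi fun i _ => (hs i).2.1) hsm
      (fun i _ => (hs i).2.2.2), volume_pi_pi]

end MeanValue

section Primitive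

open scoped ENNReal Topology
open Filter

theorem summable_one_div_add_one_pow {d : ℕ} (hd : 2 ≤ d) :
    Summable fun k : ℕ => (1 : ℝ) / (k + 1) ^ d := by
  have := (summable_nat_add_iff 1).2 (Real.summable_one_div_nat_pow.2 hd)
  simpa using this

theorem one_le_zetaR {d : ℕ} (hd : 2 ≤ d) : 1 ≤ zetaR d := by
  have := (summable_one_div_add_one_pow hd).le_tsum 0 fun k _ => by positivity
  simpa [zetaR] using this

theorem zetaR_lt_two {d : ℕ} (hd : 2 ≤ d) : zetaR d < 2 := by
  have h2 : zetaR 2 = Real.pi ^ 2 / 6 := by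
    rw [← hasSum_zeta_two.tsum_eq, hasSum_zeta_two.summable.tsum_eq_zero_add]
    simp [zetaR]
  have hle : zetaR d ≤ zetaR 2 := by
    refine (summable_one_div_add_one_pow hd).tsum_le_tsum (fun k => ?_)
      (summable_one_div_add_one_pow le_rfl)
    exact one_div_le_one_div_of_le (by positivity)
      (pow_le_pow_right₀ (by linarith [Nat.cast_nonneg (α := ℝ) k]) hd)
  have hpi : Real.pi ^ 2 < 3.15 ^ 2 :=
    pow_lt_pow_left₀ Real.pi_lt_d2 Real.pi_pos.le two_ne_zero
  rw [h2] at hle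
  norm_num at hpi
  linarith

/-- Inversion of the relation `∑ₖ f (m k) = V / m ^ d`. -/
theorem eq_div_zetaR_of_hasSum {d : ℕ} (hd : 2 ≤ d) {f : ℕ → ℝ} {V : ℝ} (hf : ∀ m, 0 ≤ f m)
    (h : ∀ m : ℕ, 1 ≤ m → HasSum (fun k => f (m * (k + 1))) (V / (m : ℝ) ^ d)) :
    f 1 = V / zetaR d := by
  have hZ1 := one_le_zetaR hd
  have hZ2 := zetaR_lt_two hd
  have hZ : HasSum (fun k : ℕ => (1 : ℝ) / (k + 1) ^ d) (zetaR d) :=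
    (summable_one_div_add_one_pow hd).hasSum
  have hZ' : HasSum (fun k : ℕ => (1 : ℝ) / ((k + 1 : ℕ) + 1) ^ d) (zetaR d - 1) := by
    simpa using (hasSum_nat_add_iff' 1).2 hZ
  let X : ℕ → ℝ := fun m => (m : ℝ) ^ d * f m - V / zetaR d
  have hX : ∀ m : ℕ, 1 ≤ m → HasSum (fun k : ℕ => X (m * (k + 1)) * (1 / (k + 1) ^ d)) 0 := by
    intro m hm
    have hm0 : (m : ℝ) ≠ 0 := by positivity
    have h1 := ((h m hm).mul_left ((m : ℝ) ^ d)).sub (hZ.mul_left (V / zetaR d))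
    rw [mul_div_cancel₀ _ (pow_ne_zero _ hm0), div_mul_cancel₀ _ (by positivity), sub_self] at h1
    refine h1.congr_fun fun k => ?_
    have hk : ((k : ℝ) + 1) ≠ 0 := by positivity
    simp only [X]
    push_cast
    rw [mul_pow]
    field_simp
  have hstep : ∀ B : ℝ, (∀ m, 1 ≤ m → |X m| ≤ B) → ∀ m, 1 ≤ m → |X m| ≤ B * (zetaR d - 1) := by
    intro B hB m hm
    have h1 := (hasSum_nat_add_iff' 1).2 (hX m hm)
    simp only [Finset.range_one, Finset.sum_singleton, Nat.cast_zero, zero_add, one_pow, mul_one,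
      div_one, zero_sub] at h1
    have h2 := tsum_of_norm_bounded (hZ'.mul_left B) (f := fun k : ℕ =>
      X (m * ((k + 1) + 1)) * (1 / ((k + 1 : ℕ) + 1) ^ d)) fun k => ?_
    · rw [h1.tsum_eq, norm_neg] at h2
      exact h2
    · rw [norm_mul, Real.norm_eq_abs, Real.norm_of_nonneg (by positivity)]
      exact mul_le_mul_of_nonneg_right (hB _ (Nat.mul_pos hm (by omega))) (by positivity)
  have hbound : ∀ m, 1 ≤ m → |X m| ≤ V + |V / zetaR d| := by
    intro m hm
    have hm0 : (0 : ℝ) < m := by exact_mod_cast hm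
    have h1 := le_hasSum (h m hm) 0 fun _ _ => hf _
    rw [zero_add, mul_one, le_div_iff₀ (by positivity)] at h1
    have h2 : 0 ≤ (m : ℝ) ^ d * f m := mul_nonneg (by positivity) (hf m)
    refine (abs_sub _ _).trans ?_
    rw [abs_of_nonneg h2]
    linarith
  have hiter : ∀ i : ℕ, ∀ m, 1 ≤ m → |X m| ≤ (V + |V / zetaR d|) * (zetaR d - 1) ^ i := by
    intro i
    induction i with
    | zero => simpa using hbound
    | succ i ih =>
      intro m hm
      rw [pow_succ, ← mul_assoc]
      exact hstep _ ih m hm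
  have hlim : Tendsto (fun i : ℕ => (V + |V / zetaR d|) * (zetaR d - 1) ^ i) atTop (𝓝 0) := by
    simpa using (tendsto_pow_atTop_nhds_zero_of_lt_one (by linarith) (by linarith)).const_mul
      (V + |V / zetaR d|)
  have h0 : |X 1| ≤ 0 := ge_of_tendsto' hlim fun i => hiter i 1 le_rfl
  have h1 : X 1 = 0 := abs_nonpos_iff.1 h0
  simp only [X, Nat.cast_one, one_pow, one_mul] at h1
  linarith

/-- The set of primitive integer vectors. -/
def primitiveVectors (n : ℕ) : Set (Fin (n + 1) → ℤ) :=
  {v | v ≠ 0 ∧ Finset.univ.gcd v = 1}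

theorem gcd_dvd_gcd_mulVec {m : Type*} [Fintype m] (M : Matrix m m ℤ) (v : m → ℤ) :
    Finset.univ.gcd v ∣ Finset.univ.gcd (M *ᵥ v) :=
  Finset.dvd_gcd fun _ _ => Finset.dvd_sum fun j _ =>
    Dvd.dvd.mul_left (Finset.gcd_dvd (Finset.mem_univ j)) _

theorem mulVec_mem_primitiveVectors {n : ℕ} (γ : SpecialLinearGroup (Fin (n + 1)) ℤ)
    (v : Fin (n + 1) → ℤ) (hv : v ∈ primitiveVectors n) :
    (γ : Matrix (Fin (n + 1)) (Fin (n + 1)) ℤ) *ᵥ v ∈ primitiveVectors n := by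
  refine ⟨mulVec_ne_zero_of_specialLinearGroup γ v hv.1, ?_⟩
  have h := gcd_dvd_gcd_mulVec (γ⁻¹ : SpecialLinearGroup (Fin (n + 1)) ℤ).1 (γ.1 *ᵥ v)
  have h' : (γ⁻¹ : SpecialLinearGroup (Fin (n + 1)) ℤ).1 *ᵥ (γ.1 *ᵥ v) = v :=
    mulVec_mulVec_of_mul_eq_one (inv_mul_cancel γ) v
  rw [h', hv.2] at h
  rw [← Finset.normalize_gcd]
  exact normalize_eq_one.2 (isUnit_of_dvd_one h)

/-- Every nonzero integer vector is uniquely a positive multiple of a primitive vector. -/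
theorem bijective_smul_primitiveVectors (n : ℕ) : Function.Bijective
    (fun kv : ℕ × primitiveVectors n => (⟨((kv.1 : ℤ) + 1) • kv.2.1,
      smul_ne_zero (by positivity) kv.2.2.1⟩ : ({0}ᶜ : Set (Fin (n + 1) → ℤ)))) := by
  have hgcd : ∀ (k : ℕ) (v : Fin (n + 1) → ℤ),
      Finset.univ.gcd (((k : ℤ) + 1) • v) = ((k : ℤ) + 1) * Finset.univ.gcd v := fun k v => by
    have := Finset.gcd_mul_left (s := Finset.univ) (f := v) (a := (k : ℤ) + 1)
    rw [Int.normalize_of_nonneg (by positivity)] at this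
    exact this
  constructor
  · rintro ⟨k, v, hv⟩ ⟨l, w, hw⟩ h
    have h1 : ((k : ℤ) + 1) • v = ((l : ℤ) + 1) • w := congrArg Subtype.val h
    have h2 := congrArg (Finset.univ.gcd) h1
    rw [hgcd, hgcd, hv.2, hw.2] at h2
    have hkl : k = l := by omega
    subst hkl
    have h3 := smul_right_injective (Fin (n + 1) → ℤ) (by positivity : ((k : ℤ) + 1) ≠ 0) h1
    subst h3
    rfl
  · rintro ⟨w, hw⟩
    obtain ⟨v, hv, hv1⟩ := Finset.extract_gcd w (Finset.univ_nonempty (α := Fin (n + 1)))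
    have hpos : 0 < Finset.univ.gcd w := by
      refine lt_of_le_of_ne ?_ fun h => hw ?_
      · exact Int.nonneg_of_normalize_eq_self Finset.normalize_gcd
      · exact funext fun i => Finset.gcd_eq_zero_iff.1 h.symm i (Finset.mem_univ i)
    obtain ⟨k, hk⟩ := Int.eq_ofNat_of_zero_le (Int.le_sub_one_of_lt hpos)
    have hk' : Finset.univ.gcd w = (k : ℤ) + 1 := by omega
    have hw' : w = ((k : ℤ) + 1) • v := funext fun i => by
      rw [← hk']
      exact hv i (Finset.mem_univ i)
    refine ⟨⟨k, v, ?_, hv1⟩, Subtype.ext hw'.symm⟩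
    rintro rfl
    exact hw (hw'.trans (smul_zero _))

theorem latticeMeasure_apply {n : ℕ} (P : Set (Fin (n + 1) → ℤ)) (x : G n ⧸ GammaSub n)
    {C : Set (Fin (n + 1) → ℝ)} (hC : MeasurableSet C) :
    latticeMeasure P x C = ∑' v : P, C.indicator 1
      ((x.out : Matrix (Fin (n + 1)) (Fin (n + 1)) ℝ) *ᵥ fun i => (v.1 i : ℝ)) :=
  (Measure.sum_apply _ hC).trans (tsum_congr fun _ => Measure.dirac_apply' _ hC)

theorem latticeMeasure_ne_zero_eq_tsum {n : ℕ} (x : G n ⧸ GammaSub n)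
    {C : Set (Fin (n + 1) → ℝ)} (hC : MeasurableSet C) :
    latticeMeasure {0}ᶜ x C =
      ∑' k : ℕ, latticeMeasure (primitiveVectors n) x ((((k : ℝ) + 1) • ·) ⁻¹' C) := by
  have hCk : ∀ k : ℕ, MeasurableSet (((((k : ℝ) + 1) • ·) : (Fin (n + 1) → ℝ) → _) ⁻¹' C) :=
    fun k => hC.preimage (measurable_const_smul _)
  rw [latticeMeasure_apply _ _ hC, tsum_congr fun k => latticeMeasure_apply _ _ (hCk k),
    ← ENNReal.tsum_prod, ← (Equiv.ofBijective _ (bijective_smul_primitiveVectors n)).tsum_eq]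
  refine tsum_congr fun kv => ?_
  have : (x.out.1 *ᵥ fun i => (((((kv.1 : ℤ) + 1) • kv.2.1) i : ℤ) : ℝ)) =
      ((kv.1 : ℝ) + 1) • (x.out.1 *ᵥ fun i => ((kv.2.1 i : ℤ) : ℝ)) := by
    rw [← mulVec_smul]
    congr 1
    ext i
    simp
  exact congrArg (C.indicator 1) this

theorem lintegral_latticeMeasure_primitiveVectors {n : ℕ} (hn : 1 ≤ n)
    (μ : Measure (G n ⧸ GammaSub n)) [IsProbabilityMeasure μ]
    (hinv : ∀ g : G n, MeasurePreserving (fun x => g • x) μ μ) {C : Set (Fin (n + 1) → ℝ)}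
    (hC : MeasurableSet C) (hCfin : volume C ≠ ∞) :
    ∫⁻ x, latticeMeasure (primitiveVectors n) x C ∂μ =
      ENNReal.ofReal ((volume C).toReal / zetaR (n + 1)) := by
  let D : ℕ → Set (Fin (n + 1) → ℝ) := fun m => ((m : ℝ) • ·) ⁻¹' C
  have hD : ∀ m, MeasurableSet (D m) := fun m => hC.preimage (measurable_const_smul _)
  have hvol : ∀ m : ℕ, 1 ≤ m → volume (D m) = ENNReal.ofReal (((m : ℝ) ^ (n + 1))⁻¹) * volume C :=
    fun m hm => by
      have hm0 : (m : ℝ) ≠ 0 := by positivity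
      rw [Measure.addHaar_preimage_smul _ hm0, Module.finrank_fin_fun, abs_of_nonneg (by positivity)]
  have hmeas : Measurable (latticeMeasure (primitiveVectors n)) :=
    measurable_latticeMeasure mulVec_mem_primitiveVectors
  let φ : ℕ → ℝ≥0∞ := fun m => ∫⁻ x, latticeMeasure (primitiveVectors n) x (D m) ∂μ
  have hsum : ∀ m, 1 ≤ m → ∑' k, φ (m * (k + 1)) = volume (D m) := by
    intro m hm
    rw [← bind_latticeMeasure_ne_zero hn μ hinv, Measure.bind_apply (hD m)
      (measurable_latticeMeasure fun γ v => mulVec_ne_zero_of_specialLinearGroup γ v).aemeasurable]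
    simp_rw [fun x => latticeMeasure_ne_zero_eq_tsum x (hD m)]
    have hae : ∀ k : ℕ, AEMeasurable (fun x => latticeMeasure (primitiveVectors n) x
        ((((k : ℝ) + 1) • ·) ⁻¹' D m)) μ := fun k =>
      ((Measure.measurable_coe ((hD m).preimage (measurable_const_smul _))).comp
        hmeas).aemeasurable
    rw [lintegral_tsum hae]
    refine tsum_congr fun k => lintegral_congr fun x => ?_
    congr 1
    ext y
    simp [D, smul_smul]
  have hfin : ∀ m, 1 ≤ m → volume (D m) ≠ ∞ := fun m hm => by
    rw [hvol m hm]
    exact ENNReal.mul_ne_top ENNReal.ofReal_ne_top hCfin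
  have hne : ∀ m, 1 ≤ m → ∑' k, φ (m * (k + 1)) ≠ ∞ := fun m hm => by
    rw [hsum m hm]
    exact hfin m hm
  have hφ : φ 1 ≠ ∞ := by simpa using ENNReal.ne_top_of_tsum_ne_top (hne 1 le_rfl) 0
  have h := eq_div_zetaR_of_hasSum (d := n + 1) (by omega) (f := fun m => (φ m).toReal)
    (V := (volume C).toReal) (fun m => ENNReal.toReal_nonneg) fun m hm => ?_
  · rw [← h, ENNReal.ofReal_toReal hφ]
    simp [φ, D]
  · have h2 := ENNReal.hasSum_toReal (hne m hm)
    rw [← ENNReal.tsum_toReal_eq fun k => ENNReal.ne_top_of_tsum_ne_top (hne m hm) k, hsum m hm,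
      hvol m hm, ENNReal.toReal_mul, ENNReal.toReal_ofReal (by positivity), inv_mul_eq_div] at h2
    exact h2

end Primitive

section ConeVolume

open scoped ENNReal

theorem sigma_one_pos {n : ℕ} (hn : 1 ≤ n) : 0 < sigma n 1 := by
  have := one_le_zetaR (d := n + 1) (by omega)
  unfold sigma
  positivity

theorem mem_Cone_iff {n : ℕ} (hn : 1 ≤ n) (A : Set (Fin n → ℝ)) (v : Fin (n + 1) → ℝ) :
    v ∈ Cone n A ↔ v (Fin.last n) ∈ Set.Ioc (0 : ℝ) 1 ∧
      (sigma n 1 ^ (-(1 : ℝ) / n) * v (Fin.last n))⁻¹ • (fun i : Fin n => v i.castSucc) ∈ A := by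
  have hc : 0 < sigma n 1 ^ (-(1 : ℝ) / n) := Real.rpow_pos_of_pos (sigma_one_pos hn) _
  constructor
  · rintro ⟨h0, h1, h⟩
    exact ⟨⟨h0, h1⟩, (Set.mem_smul_set_iff_inv_smul_mem₀ (by positivity) _ _).1 h⟩
  · rintro ⟨⟨h0, h1⟩, h⟩
    exact ⟨h0, h1, (Set.mem_smul_set_iff_inv_smul_mem₀ (by positivity) _ _).2 h⟩

theorem measurableSet_Cone {n : ℕ} (hn : 1 ≤ n) {A : Set (Fin n → ℝ)} (hA : MeasurableSet A) :
    MeasurableSet (Cone n A) := by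
  have h : Cone n A = (fun v => v (Fin.last n)) ⁻¹' Set.Ioc (0 : ℝ) 1 ∩
      (fun v => (sigma n 1 ^ (-(1 : ℝ) / n) * v (Fin.last n))⁻¹ •
        (fun i : Fin n => v i.castSucc)) ⁻¹' A :=
    Set.ext fun v => mem_Cone_iff hn A v
  rw [h]
  refine (measurableSet_Ioc.preimage (measurable_pi_apply _)).inter (hA.preimage ?_)
  exact ((measurable_pi_apply _).const_mul _).inv.smul
    (measurable_pi_lambda _ fun i => measurable_pi_apply _)

theorem volume_Cone {n : ℕ} (hn : 1 ≤ n) {A : Set (Fin n → ℝ)} (hA : MeasurableSet A) :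
    volume (Cone n A) = ENNReal.ofReal (zetaR (n + 1)) * volume A := by
  have hσ := sigma_one_pos hn
  have hz : 0 < zetaR (n + 1) := zero_lt_one.trans_le (one_le_zetaR (by omega))
  set c := sigma n 1 ^ (-(1 : ℝ) / n) with hcdef
  have hc : 0 < c := Real.rpow_pos_of_pos hσ _
  have hcn : c ^ n = (n + 1) * zetaR (n + 1) := by
    have hn0 : (n : ℝ) ≠ 0 := by positivity
    rw [hcdef, ← Real.rpow_natCast, ← Real.rpow_mul hσ.le, div_mul_cancel₀ _ hn0, Real.rpow_neg_one,
      sigma, one_pow, one_div, inv_inv]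
  let S : Set (ℝ × (Fin n → ℝ)) := {z | z.1 ∈ Set.Ioc (0 : ℝ) 1 ∧ (c * z.1)⁻¹ • z.2 ∈ A}
  have hS : MeasurableSet S := by
    refine (measurableSet_Ioc.preimage measurable_fst).inter (hA.preimage ?_)
    exact (measurable_fst.const_mul _).inv.smul measurable_snd
  have hpre : Cone n A = MeasurableEquiv.piFinSuccAbove (fun _ => ℝ) (Fin.last n) ⁻¹' S := by
    ext v
    have hv : MeasurableEquiv.piFinSuccAbove (fun _ => ℝ) (Fin.last n) v =
        (v (Fin.last n), fun i => v i.castSucc) :=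
      Prod.ext rfl (funext fun i => congrArg v (Fin.succAbove_last_apply i))
    rw [Set.mem_preimage, hv]
    exact mem_Cone_iff hn A v
  rw [hpre, (volume_preserving_piFinSuccAbove (fun _ => ℝ) (Fin.last n)).measure_preimage
    hS.nullMeasurableSet, Measure.volume_eq_prod, Measure.prod_apply hS]
  have hsec : ∀ y, volume (Prod.mk y ⁻¹' S) =
      (Set.Ioc (0 : ℝ) 1).indicator (fun y => ENNReal.ofReal ((c * y) ^ n)) y * volume A := by
    intro y
    by_cases hy : y ∈ Set.Ioc (0 : ℝ) 1
    · have h : Prod.mk y ⁻¹' S = ((c * y)⁻¹ • ·) ⁻¹' A := by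
        ext x
        simp only [S, Set.mem_preimage, Set.mem_ofPred_eq, hy, true_and]
      have hcy : 0 < c * y := mul_pos hc hy.1
      rw [h, Measure.addHaar_preimage_smul _ (inv_ne_zero hcy.ne'), Set.indicator_of_mem hy,
        Module.finrank_fin_fun, inv_pow, inv_inv, abs_of_nonneg (by positivity)]
    · have h : Prod.mk y ⁻¹' S = ∅ := Set.eq_empty_of_forall_notMem fun x hx => hy hx.1
      rw [h, Set.indicator_of_notMem hy, measure_empty, zero_mul]
  simp_rw [hsec]
  rw [lintegral_mul_const _ (by fun_prop (disch := measurability)),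
    lintegral_indicator measurableSet_Ioc, ← ofReal_integral_eq_lintegral_ofReal]
  · congr 2
    rw [← intervalIntegral.integral_of_le zero_le_one]
    simp_rw [mul_pow, hcn]
    rw [intervalIntegral.integral_const_mul, integral_pow]
    field_simp
    simp
  · exact ((continuous_const.mul continuous_id).pow n).integrableOn_Ioc
  · exact (ae_restrict_mem measurableSet_Ioc).mono fun y hy => by
      have := hy.1
      positivity

end ConeVolume

theorem toReal_latticeMeasure_primitiveVectors_mk {n : ℕ} (g : G n) {C : Set (Fin (n + 1) → ℝ)}
    (hC : MeasurableSet C) :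
    (latticeMeasure (primitiveVectors n) (g : G n ⧸ GammaSub n) C).toReal =
      ({v : Fin (n + 1) → ℤ | v ≠ 0 ∧ Finset.univ.gcd v = 1 ∧
        Matrix.mulVec (g : Matrix (Fin (n + 1)) (Fin (n + 1)) ℝ) (fun i => (v i : ℝ)) ∈
          C}).ncard := by
  set S := {v : Fin (n + 1) → ℤ | v ≠ 0 ∧ Finset.univ.gcd v = 1 ∧
    Matrix.mulVec (g : Matrix (Fin (n + 1)) (Fin (n + 1)) ℝ) (fun i => (v i : ℝ)) ∈ C}
  have h : latticeMeasure (primitiveVectors n) (g : G n ⧸ GammaSub n) C = S.encard := by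
    rw [latticeMeasure_mk_apply mulVec_mem_primitiveVectors g hC, ← ENNReal.tsum_set_one,
      tsum_subtype S fun _ => (1 : ENNReal), tsum_subtype (primitiveVectors n) fun v =>
        C.indicator (1 : (Fin (n + 1) → ℝ) → ENNReal) ((g : Matrix (Fin (n + 1)) (Fin (n + 1)) ℝ) *ᵥ
          fun i => (v i : ℝ))]
    refine tsum_congr fun v => ?_
    classical
    simp only [Set.indicator_apply, primitiveVectors, S, Set.mem_ofPred_eq, Pi.one_apply, ← ite_and,
      and_assoc]
  rw [h, Set.ncard]
  cases hS : S.encard using ENat.recTopCoe with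
  | top => simp
  | coe m => simp

/-- Siegel's mean value theorem for primitive vectors applied to the cone
C(A): the expected number of primitive lattice points in C(A) over the space of lattices
(with any G-invariant probability measure μ) equals vol(C(A))/ζ(n+1) = vol(A). -/
theorem siegel_mean_value_cone (n : ℕ) (hn : 1 ≤ n) (A : Set (Fin n → ℝ))
    (hAbd : Bornology.IsBounded A) (hAm : MeasurableSet A)
    (μ : Measure (G n ⧸ GammaSub n)) [IsProbabilityMeasure μ]
    (hinv : ∀ g : G n, MeasurePreserving (fun x => g • x) μ μ)
    (F : G n ⧸ GammaSub n → ℝ)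
    (hF : ∀ g : G n, F (QuotientGroup.mk g) =
      ({v : Fin (n + 1) → ℤ | v ≠ 0 ∧ Finset.univ.gcd v = 1 ∧
        Matrix.mulVec (g : Matrix (Fin (n + 1)) (Fin (n + 1)) ℝ) (fun i => (v i : ℝ)) ∈
          Cone n A}).ncard) :
    (volume (Cone n A)).toReal = zetaR (n + 1) * (volume A).toReal ∧
    ∫ x, F x ∂μ = (volume (Cone n A)).toReal / zetaR (n + 1) := by
  have hz : 0 < zetaR (n + 1) := zero_lt_one.trans_le (one_le_zetaR (by omega))
  have hvol := volume_Cone hn hAm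
  have hCm := measurableSet_Cone hn hAm
  refine ⟨by rw [hvol, ENNReal.toReal_mul, ENNReal.toReal_ofReal hz.le], ?_⟩
  have hfin : volume (Cone n A) ≠ ⊤ := by
    rw [hvol]
    exact ENNReal.mul_ne_top ENNReal.ofReal_ne_top hAbd.measure_lt_top.ne
  have hmeas : Measurable fun x => latticeMeasure (primitiveVectors n) x (Cone n A) :=
    (Measure.measurable_coe hCm).comp (measurable_latticeMeasure mulVec_mem_primitiveVectors)
  have hint := lintegral_latticeMeasure_primitiveVectors hn μ hinv hCm hfin
  have hFeq : ∀ x, F x = (latticeMeasure (primitiveVectors n) x (Cone n A)).toReal := fun x => by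
    induction x using QuotientGroup.induction_on with
    | H g => rw [hF, toReal_latticeMeasure_primitiveVectors_mk g hCm]
  rw [integral_congr_ae (.of_forall hFeq), integral_toReal hmeas.aemeasurable
    (ae_lt_top hmeas (by rw [hint]; exact ENNReal.ofReal_ne_top)), hint, ENNReal.toReal_ofReal]
  positivity
end
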